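/- arXiv:2301.11073 — 7 statements merged into one kernel-verified Lean document; each statement's English description precedes it below -/
import Mathlib

section
/- Let T be a tree, v a vertex of T, B_0 a branch of T at v, s ≥ 1, and t = (t_0,…,t_s) a positive real vector with t_0 + … + t_s = 1. Let T' be the s-branch duplication of B_0 at v, let A ∈ R(T), and let A' ∈ R(T') be an s-summand duplication of A[B_0] at v relative to t. Then, as multisets, spec(A') = spec(A) ∪ s·spec(A[B_0]), where s·Σ denotes the multiset Σ with every multiplicity multiplied by s. -/
/-- `A ∈ 𝓡(G)`: for `u ≠ w` the entry `A u w` is nonzero iff `{u,w}` is an edge of `G`,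
and `A u w * A w u > 0` for every edge `{u,w}` of `G`. -/
def MatrRG {V : Type*} (G : SimpleGraph V) (A : Matrix V V ℝ) : Prop :=
  (∀ u w, u ≠ w → (A u w ≠ 0 ↔ G.Adj u w)) ∧
  (∀ u w, G.Adj u w → 0 < A u w * A w u)

/-- The `s`-branch duplication `T'` of the branch `B₀` (with connecting vertex `b₀`)
at `v` in `T`: the tree obtained from `T` by adding `s` disjoint copies of `B₀`, the copy
of each `x ∈ B₀` in copy `i` being `Sum.inr (i, x)`, each copy joined to `v` by an edge
from the copy of `b₀`. -/
def dupGraph {V : Type*} (T : SimpleGraph V) (v : V) (B0 : Finset V) (b0 : V) (s : ℕ) :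
    SimpleGraph (V ⊕ Fin s × {x // x ∈ B0}) :=
  SimpleGraph.fromRel (fun x y =>
    match x, y with
    | Sum.inl u, Sum.inl w => T.Adj u w
    | Sum.inr (i, x), Sum.inr (j, y) => i = j ∧ T.Adj (x : V) (y : V)
    | Sum.inl u, Sum.inr (_, x) => u = v ∧ (x : V) = b0
    | Sum.inr _, Sum.inl _ => False)

/-- A vertex `v` outside a connected vertex set `B0` of a tree has at most one neighbour in it. -/
theorem neighbor_unique {V : Type*} (T : SimpleGraph V) (hT : T.IsTree)
    (v : V) (B0 : Finset V) (hv : v ∉ B0)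
    (hconn : (T.induce (B0 : Set V)).Connected)
    (b0 : V) (hb0 : b0 ∈ B0) (hvb0 : T.Adj v b0) :
    ∀ x ∈ B0, T.Adj v x → x = b0 := by
  classical
  intro x hx hvx
  by_contra hne
  obtain ⟨p, hp⟩ := (hconn.preconnected ⟨x, hx⟩ ⟨b0, hb0⟩).exists_isPath
  let f := (SimpleGraph.Embedding.induce (G := T) (B0 : Set V))
  let q : T.Walk x b0 := p.map f.toHom
  have hq : q.IsPath := SimpleGraph.Walk.map_isPath_of_injective f.injective hp
  have hvq : v ∉ q.support := by
    intro h
    have h := (List.mem_map.1 ((SimpleGraph.Walk.support_map f.toHom p) ▸ h))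
    obtain ⟨y, -, hy⟩ := h
    exact hv (hy ▸ y.2)
  let r : T.Walk x b0 := SimpleGraph.Walk.cons hvx.symm (SimpleGraph.Walk.cons hvb0 .nil)
  have hr : r.IsPath := by
    simp [r, SimpleGraph.Walk.cons_isPath_iff, hvx.ne', hvb0.ne, hne]
  have := hT.isAcyclic.path_unique ⟨q, hq⟩ ⟨r, hr⟩
  have h2 : q = r := congrArg Subtype.val this
  apply hvq
  rw [h2]
  simp [r]

/-- (Proposition 3.3) Let `T` be a tree, `B₀` a branch of `T` at `v`
joined to `v` via `b₀`, `s ≥ 1`, and `t = (t_0, …, t_s)` a positive vector summing to `1`.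
If `A ∈ 𝓡(T)` and `A' ∈ 𝓡(T')` is an `s`-summand duplication of `A[B₀]` at `v` relative
to `t`, then, as multisets, `spec(A') = spec(A) ∪ s · spec(A[B₀])`. -/
theorem spec_of_summand_duplication {V : Type*} [Fintype V] [DecidableEq V]
    (T : SimpleGraph V) (hT : T.IsTree)
    (v : V) (B0 : Finset V) (hv : v ∉ B0)
    (hconn : (T.induce (B0 : Set V)).Connected)
    (hbranch : ∀ x ∈ B0, ∀ y, y ∉ B0 → T.Adj x y → y = v)
    (b0 : V) (hb0 : b0 ∈ B0) (hvb0 : T.Adj v b0)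
    (s : ℕ) (hs : 1 ≤ s)
    (t : Fin (s + 1) → ℝ) (ht : ∀ i, 0 < t i) (htsum : ∑ i, t i = 1)
    (A : Matrix V V ℝ) (hA : MatrRG T A)
    (A' : Matrix (V ⊕ Fin s × {x // x ∈ B0}) (V ⊕ Fin s × {x // x ∈ B0}) ℝ)
    (hA' : MatrRG (dupGraph T v B0 b0 s) A')
    (houter : ∀ u w : V, u ∉ B0 → w ∉ B0 → A' (Sum.inl u) (Sum.inl w) = A u w)
    (hcopy0 : ∀ x y : V, x ∈ B0 → y ∈ B0 → A' (Sum.inl x) (Sum.inl y) = A x y)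
    (hcopy : ∀ (i : Fin s) (x y : {x // x ∈ B0}),
      A' (Sum.inr (i, x)) (Sum.inr (i, y)) = A (x : V) (y : V))
    (hedge0 : A' (Sum.inl v) (Sum.inl b0) * A' (Sum.inl b0) (Sum.inl v)
        = t 0 * (A v b0 * A b0 v))
    (hedgei : ∀ i : Fin s,
      A' (Sum.inl v) (Sum.inr (i, ⟨b0, hb0⟩)) * A' (Sum.inr (i, ⟨b0, hb0⟩)) (Sum.inl v)
        = t i.succ * (A v b0 * A b0 v)) :
    A'.charpoly.roots
      = A.charpoly.roots
        + s • (A.submatrix (fun x : {x // x ∈ B0} => (x : V))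
            (fun x : {x // x ∈ B0} => (x : V))).charpoly.roots := by
  classical
  have huniq := neighbor_unique T hT v B0 hv hconn b0 hb0 hvb0
  obtain ⟨hA1, hA2⟩ := hA
  obtain ⟨hA'1, hA'2⟩ := hA'
  have hbv : A b0 v ≠ 0 := (hA1 b0 v hvb0.ne').2 hvb0.symm
  -- zero patterns of A
  have hAz1 : ∀ x ∈ B0, ∀ y, y ∉ B0 → ¬ (x = b0 ∧ y = v) → A x y = 0 := by
    intro x hx y hy hne
    by_contra h
    have hadj := (hA1 x y (by rintro rfl; exact hy hx)).1 h
    have h1 := hbranch x hx y hy hadj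
    subst h1
    exact hne ⟨huniq x hx hadj.symm, rfl⟩
  have hAz2 : ∀ x ∈ B0, ∀ y, y ∉ B0 → ¬ (x = b0 ∧ y = v) → A y x = 0 := by
    intro x hx y hy hne
    by_contra h
    have hadj := (hA1 y x (by rintro rfl; exact hy hx)).1 h
    have h1 := hbranch x hx y hy hadj.symm
    subst h1
    exact hne ⟨huniq x hx hadj, rfl⟩
  have hll : ∀ x y : V, (dupGraph T v B0 b0 s).Adj (Sum.inl x) (Sum.inl y) ↔ T.Adj x y := by
    intro x y
    simp only [dupGraph, SimpleGraph.fromRel_adj]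
    constructor
    · rintro ⟨-, h | h⟩
      · exact h
      · exact h.symm
    · intro h
      exact ⟨fun e => h.ne (Sum.inl.inj e), Or.inl h⟩
  have hlr : ∀ (u : V) (p : Fin s × {x // x ∈ B0}),
      (dupGraph T v B0 b0 s).Adj (Sum.inl u) (Sum.inr p) ↔ u = v ∧ (p.2 : V) = b0 := by
    intro u p
    simp [dupGraph, SimpleGraph.fromRel_adj]
  have hrr : ∀ (p q : Fin s × {x // x ∈ B0}),
      (dupGraph T v B0 b0 s).Adj (Sum.inr p) (Sum.inr q) → p.1 = q.1 := by
    intro p q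
    simp only [dupGraph, SimpleGraph.fromRel_adj]
    rintro ⟨-, h | h⟩
    · exact h.1
    · exact h.1.symm
  have hBz : ∀ x y : V, x ≠ y → A x y = 0 → A' (Sum.inl x) (Sum.inl y) = 0 := by
    intro x y hxy h
    by_contra h'
    exact (hA1 x y hxy).2 ((hll x y).1 ((hA'1 _ _ (fun e => hxy (Sum.inl.inj e))).1 h')) h
  have hCz : ∀ (u : V) (p : Fin s × {x // x ∈ B0}), ¬ (u = v ∧ (p.2 : V) = b0) →
      A' (Sum.inl u) (Sum.inr p) = 0 := by
    intro u p h
    by_contra h'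
    exact h ((hlr u p).1 ((hA'1 _ _ (by simp)).1 h'))
  have hGz : ∀ (u : V) (p : Fin s × {x // x ∈ B0}), ¬ (u = v ∧ (p.2 : V) = b0) →
      A' (Sum.inr p) (Sum.inl u) = 0 := by
    intro u p h
    by_contra h'
    exact h ((hlr u p).1 ((hA'1 _ _ (by simp)).1 h').symm)
  have hDz : ∀ (p q : Fin s × {x // x ∈ B0}), p.1 ≠ q.1 →
      A' (Sum.inr p) (Sum.inr q) = 0 := by
    intro p q h
    by_contra h'
    exact h (hrr p q ((hA'1 _ _ (fun e => h (by rw [Sum.inr.inj e]))).1 h'))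
  set c0 : ℝ := A' (Sum.inl b0) (Sum.inl v) / A b0 v with hc0
  let c : Fin s → ℝ := fun i => A' (Sum.inr (i, ⟨b0, hb0⟩)) (Sum.inl v) / A b0 v
  have hc0ne : c0 ≠ 0 := by
    refine div_ne_zero ?_ hbv
    exact (hA'1 _ _ (fun e => hvb0.ne' (Sum.inl.inj e))).2 ((hll _ _).2 hvb0.symm)
  have hkey : A' (Sum.inl v) (Sum.inl b0) * c0
      + ∑ i, A' (Sum.inl v) (Sum.inr (i, ⟨b0, hb0⟩)) * c i = A v b0 := by
    have e0 : A' (Sum.inl v) (Sum.inl b0) * c0 = t 0 * A v b0 := by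
      rw [hc0, ← mul_div_assoc, hedge0]; field_simp
    have ei : ∀ i, A' (Sum.inl v) (Sum.inr (i, ⟨b0, hb0⟩)) * c i = t i.succ * A v b0 := by
      intro i
      simp only [c]
      rw [← mul_div_assoc, hedgei]; field_simp
    rw [e0, Finset.sum_congr rfl (fun i _ => ei i), ← Finset.sum_mul, ← add_mul,
      ← Fin.sum_univ_succ, htsum, one_mul]
  let d : V → ℝ := fun u => if u ∈ B0 then c0 else 1
  let F : Matrix (Fin s × {x // x ∈ B0}) V ℝ :=
    Matrix.of fun p u => if (p.2 : V) = u then c p.1 else 0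
  let B : Matrix {x // x ∈ B0} {x // x ∈ B0} ℝ :=
    A.submatrix (fun x : {x // x ∈ B0} => (x : V)) (fun x : {x // x ∈ B0} => (x : V))
  let P := Matrix.fromBlocks (Matrix.diagonal d) 0 F 
    (1 : Matrix (Fin s × {x // x ∈ B0}) (Fin s × {x // x ∈ B0}) ℝ)
  let M := Matrix.fromBlocks A A'.toBlocks₁₂ 0 A'.toBlocks₂₂
  have hFsum : ∀ (g : Fin s × {x // x ∈ B0} → ℝ) (w : V),
      ∑ p, g p * F p w = if h : w ∈ B0 then ∑ i, g (i, ⟨w, h⟩) * c i else 0 := by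
    intro g w
    rw [Fintype.sum_prod_type]
    split_ifs with h
    · refine Finset.sum_congr rfl fun i _ => ?_
      rw [Finset.sum_eq_single ⟨w, h⟩]
      · simp [F]
      · intro y _ hy
        have : (y : V) ≠ w := fun e => hy (Subtype.ext e)
        simp [F, this]
      · simp
    · refine Finset.sum_eq_zero fun i _ => Finset.sum_eq_zero fun y _ => ?_
      have : (y : V) ≠ w := fun e => h (e ▸ y.2)
      simp [F, this]
  have hPM : A' * P = P * M := by
    conv_lhs => rw [← Matrix.fromBlocks_toBlocks A']
    simp only [P, M, Matrix.fromBlocks_multiply, Matrix.mul_zero, Matrix.zero_mul,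
      Matrix.mul_one, Matrix.one_mul, zero_add, add_zero]
    congr 1
    · ext u w
      rw [Matrix.add_apply, Matrix.mul_diagonal, Matrix.diagonal_mul, Matrix.mul_apply, hFsum]
      simp only [Matrix.toBlocks₁₁, Matrix.toBlocks₁₂, Matrix.of_apply, d]
      by_cases hu : u ∈ B0
      · have huv : u ≠ v := by rintro rfl; exact hv hu
        by_cases hw : w ∈ B0
        · rw [dif_pos hw, if_pos hw, if_pos hu, Finset.sum_eq_zero, hcopy0 u w hu hw]
          · ring
          · intro i _
            rw [hCz _ _ (fun h => huv h.1), zero_mul]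
        · rw [dif_neg hw, if_neg hw, if_pos hu]
          by_cases hh : u = b0 ∧ w = v
          · obtain ⟨rfl, rfl⟩ := hh
            rw [hc0]; field_simp; simp
          · have hz := hAz1 u hu w hw hh
            rw [hz, hBz u w (by rintro rfl; exact hw hu) hz]; simp
      · by_cases hw : w ∈ B0
        · rw [dif_pos hw, if_pos hw, if_neg hu]
          by_cases hh : w = b0 ∧ u = v
          · obtain ⟨rfl, rfl⟩ := hh
            rw [hkey, one_mul]
          · have hz := hAz2 w hw u hu hh
            rw [hz, hBz u w (by rintro rfl; exact hu hw) hz, Finset.sum_eq_zero]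
            · simp
            · intro i _
              rw [hCz _ _ (fun h => hh ⟨h.2, h.1⟩), zero_mul]
        · rw [dif_neg hw, if_neg hw, if_neg hu, houter u w hu hw]; ring
    · ext u p
      rw [Matrix.diagonal_mul]
      simp only [Matrix.toBlocks₁₂, Matrix.of_apply, d]
      by_cases hu : u ∈ B0
      · rw [hCz u p (by rintro ⟨rfl, -⟩; exact hv hu), mul_zero]
      · rw [if_neg hu, one_mul]
    · ext p w
      obtain ⟨i, x⟩ := p
      rw [Matrix.add_apply, Matrix.mul_diagonal, Matrix.mul_apply, Matrix.mul_apply, hFsum]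
      have hR : ∑ j, F (i, x) j * A j w = c i * A x w := by
        rw [Finset.sum_eq_single (x : V)]
        · simp [F]
        · intro y _ hy
          simp [F, Ne.symm hy]
        · simp
      rw [hR]
      simp only [Matrix.toBlocks₂₁, Matrix.toBlocks₂₂, Matrix.of_apply, d]
      by_cases hw : w ∈ B0
      · rw [dif_pos hw, if_pos hw, hGz w (i, x) (by rintro ⟨rfl, -⟩; exact hv hw),
          Finset.sum_eq_single i]
        · rw [hcopy]; ring
        · intro j _ hj
          rw [hDz _ _ (Ne.symm hj), zero_mul]
        · simp
      · rw [dif_neg hw, if_neg hw]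
        by_cases hh : (x : V) = b0 ∧ w = v
        · obtain ⟨hx, rfl⟩ := hh
          have : x = ⟨b0, hb0⟩ := Subtype.ext hx
          subst this
          simp only [c]
          field_simp; simp
        · rw [hAz1 x x.2 w hw hh, hGz w (i, x) (fun h => hh ⟨h.2, h.1⟩)]; simp
    · ext p q
      rw [Matrix.add_apply, Matrix.mul_apply, Finset.sum_eq_zero, zero_add]
      intro u _
      simp only [Matrix.toBlocks₁₂, Matrix.of_apply, F]
      split_ifs with h
      · rw [hCz u q, mul_zero]
        rintro ⟨rfl, -⟩
        exact hv (h ▸ p.2.2)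
      · rw [zero_mul]
  have hPdet : IsUnit P := by
    rw [Matrix.isUnit_iff_isUnit_det, isUnit_iff_ne_zero]
    simp only [P, Matrix.det_fromBlocks_zero₁₂, Matrix.det_diagonal, Matrix.det_one, mul_one]
    refine Finset.prod_ne_zero_iff.2 fun u _ => ?_
    simp only [d]
    split_ifs
    · exact hc0ne
    · exact one_ne_zero
  have hchar : A'.charpoly = M.charpoly := by
    obtain ⟨U, hU⟩ := hPdet
    have : A' = U.val * M * U⁻¹.val := by
      rw [hU, ← hPM, ← hU, mul_assoc, Units.mul_inv, mul_one]
    rw [this]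
    rw [Matrix.coe_units_inv]
    exact Matrix.charpoly_units_conj U M
  have hD : A'.toBlocks₂₂ = Matrix.reindex (Equiv.prodComm _ _) (Equiv.prodComm _ _)
      (Matrix.blockDiagonal (fun _ : Fin s => B)) := by
    ext ⟨i, x⟩ ⟨j, y⟩
    by_cases hij : i = j
    · subst hij
      simp [Matrix.toBlocks₂₂, Matrix.blockDiagonal_apply, B, hcopy]
    · simp [Matrix.toBlocks₂₂, Matrix.blockDiagonal_apply, hij, hDz (i, x) (j, y) hij]
  have hBD : (Matrix.blockDiagonal (fun _ : Fin s => B)).charpoly = B.charpoly ^ s := by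
    have : (Matrix.blockDiagonal (fun _ : Fin s => B)).charmatrix
        = Matrix.blockDiagonal (fun _ : Fin s => B.charmatrix) := by
      ext1 ⟨x, i⟩ ⟨y, j⟩
      by_cases hij : i = j
      · subst hij
        simp [Matrix.charmatrix_apply, Matrix.blockDiagonal_apply, Matrix.diagonal_apply]
      · simp [Matrix.charmatrix_apply, Matrix.blockDiagonal_apply, Matrix.diagonal_apply, hij]
    rw [Matrix.charpoly, this, Matrix.det_blockDiagonal]
    simp [Matrix.charpoly]
  rw [hchar, Matrix.charpoly_fromBlocks_zero₂₁, hD, Matrix.charpoly_reindex, hBD,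
    Polynomial.roots_mul, Polynomial.roots_pow]
  exact mul_ne_zero (Matrix.charpoly_monic A).ne_zero
    (pow_ne_zero _ (Matrix.charpoly_monic B).ne_zero)
end

section
/- For the recursively defined tridiagonal matrices C_n, for every k ≥ 2 the spectra of C_{k−1} and C_k are disjoint. -/
/-- The recursively defined tridiagonal matrices `C_n`: `C_n` is tridiagonal with
diagonal `(a_n, …, a_1)`, superdiagonal `(b_n, …, b_2)` and all subdiagonal entries `1`;
equivalently `C_1 = (a_1)` and `C_{k+1}` has `(1,1)` entry `a_{k+1}`, `(1,2)` entry
`b_{k+1}`, `(2,1)` entry `1`, and trailing principal `k×k` submatrix `C_k`. -/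
def triC (a b : ℕ → ℝ) (n : ℕ) : Matrix (Fin n) (Fin n) ℝ :=
  Matrix.of fun j k =>
    if j.val = k.val then a (n - j.val)
    else if j.val + 1 = k.val then b (n - j.val)
    else if k.val + 1 = j.val then 1
    else 0

theorem triC_det_rec (a b : ℕ → ℝ) (x : ℝ) (n : ℕ) :
    (Matrix.scalar (Fin (n+2)) x - triC a b (n+2)).det =
      (x - a (n+2)) * (Matrix.scalar (Fin (n+1)) x - triC a b (n+1)).det
        - b (n+2) * (Matrix.scalar (Fin n) x - triC a b n).det := by
  have h1 : (Matrix.scalar (Fin (n+2)) x - triC a b (n+2)).submatrix Fin.succ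
      (Fin.succAbove 0) = Matrix.scalar (Fin (n+1)) x - triC a b (n+1) := by
    ext i j
    simp [triC, Matrix.diagonal_apply]
  have h2 : ((Matrix.scalar (Fin (n+2)) x - triC a b (n+2)).submatrix Fin.succ
      (Fin.succAbove (Fin.succ 0))).det = - (Matrix.scalar (Fin n) x - triC a b n).det := by
    rw [Matrix.det_succ_column_zero, Fin.sum_univ_succ, Finset.sum_eq_zero]
    · have h3 : (((Matrix.scalar (Fin (n+2)) x - triC a b (n+2)).submatrix Fin.succ
        (Fin.succAbove (Fin.succ 0))).submatrix (Fin.succAbove 0) Fin.succ)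
          = Matrix.scalar (Fin n) x - triC a b n := by
        ext i j
        simp [triC, Matrix.diagonal_apply]
      rw [h3]
      simp [triC, Matrix.diagonal_apply]
    · intro i _
      simp [triC, Matrix.diagonal_apply]
  rw [Matrix.det_succ_row_zero, Fin.sum_univ_succ, Fin.sum_univ_succ, Finset.sum_eq_zero, h1, h2]
  · simp [triC, Matrix.diagonal_apply]
    ring
  · intro i _
    simp [triC, Matrix.diagonal_apply, Fin.ext_iff]

theorem triC_aux (a b : ℕ → ℝ) (hb : ∀ k, 2 ≤ k → 0 < b k) (x : ℝ) (n : ℕ) :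
    ¬ ((Matrix.scalar (Fin n) x - triC a b n).det = 0 ∧
      (Matrix.scalar (Fin (n+1)) x - triC a b (n+1)).det = 0) := by
  induction n with
  | zero => simp
  | succ n ih =>
    rintro ⟨h1, h2⟩
    rw [triC_det_rec, h1] at h2
    have := hb (n+2) (by omega)
    refine ih ⟨?_, h1⟩
    have h3 : b (n+2) * (Matrix.scalar (Fin n) x - triC a b n).det = 0 := by linarith
    exact (mul_eq_zero.mp h3).resolve_left this.ne'

/-- (Lemma 4.1(1)) For the recursively defined tridiagonal matrices `C_n`,
for every `k ≥ 2` the spectra of `C_{k-1}` and `C_k` are disjoint. -/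
theorem triC_spectra_disjoint (a b : ℕ → ℝ) (hb : ∀ k, 2 ≤ k → 0 < b k)
    (k : ℕ) (hk : 2 ≤ k) (x : ℝ) :
    ¬((triC a b (k - 1)).charpoly.IsRoot x ∧ (triC a b k).charpoly.IsRoot x) := by
  obtain ⟨n, rfl⟩ : ∃ n, k = n + 1 := ⟨k - 1, by omega⟩
  simp only [Polynomial.IsRoot, Matrix.eval_charpoly, Nat.add_sub_cancel]
  exact triC_aux a b hb x n
end

section
/- For the recursively defined tridiagonal matrices C_n, if k ≥ 3 and α is an eigenvalue of C_{k−2}, then α is an eigenvalue of C_k if and only if a_k = α. -/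
theorem triC_charpoly_det (a b : ℕ → ℝ) (n : ℕ) (x : ℝ) :
    (triC a b n).charpoly.eval x = (Matrix.scalar (Fin n) x - triC a b n).det :=
  Matrix.eval_charpoly _ _

theorem triC_scalar_sub_apply (a b : ℕ → ℝ) (n : ℕ) (x : ℝ) (i j : Fin n) :
    (Matrix.scalar (Fin n) x - triC a b n) i j =
      if i.val = j.val then x - a (n - i.val)
      else if i.val + 1 = j.val then - b (n - i.val)
      else if j.val + 1 = i.val then -1 else 0 := by
  simp only [Matrix.sub_apply, Matrix.scalar_apply, Matrix.diagonal_apply, triC,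
    Matrix.of_apply, Fin.ext_iff]
  split_ifs <;> simp

theorem triC_rec (a b : ℕ → ℝ) (n : ℕ) (x : ℝ) :
    (triC a b (n + 2)).charpoly.eval x =
      (x - a (n + 2)) * (triC a b (n + 1)).charpoly.eval x
        - b (n + 2) * (triC a b n).charpoly.eval x := by
  simp only [triC_charpoly_det]
  rw [Matrix.det_succ_column_zero, Fin.sum_univ_succ, Fin.sum_univ_succ,
    Finset.sum_eq_zero]
  · have h1 : (Matrix.scalar (Fin (n + 2)) x - triC a b (n + 2)).submatrix
        (Fin.succAbove 0) Fin.succ = Matrix.scalar (Fin (n + 1)) x - triC a b (n + 1) := by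
      ext i j
      rw [Matrix.submatrix_apply, triC_scalar_sub_apply, triC_scalar_sub_apply]
      have e : n + 2 - (i.val + 1) = n + 1 - i.val := by omega
      simp [e]
    have h2 : ((Matrix.scalar (Fin (n + 2)) x - triC a b (n + 2)).submatrix
        (Fin.succAbove (Fin.succ 0)) Fin.succ).det
          = - b (n + 2) * (Matrix.scalar (Fin n) x - triC a b n).det := by
      rw [Matrix.det_succ_row_zero, Fin.sum_univ_succ, Finset.sum_eq_zero]
      · have h3 : ((Matrix.scalar (Fin (n + 2)) x - triC a b (n + 2)).submatrix
            (Fin.succAbove (Fin.succ 0)) Fin.succ).submatrix Fin.succ (Fin.succAbove 0)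
            = Matrix.scalar (Fin n) x - triC a b n := by
          ext i j
          rw [Matrix.submatrix_apply, Matrix.submatrix_apply, triC_scalar_sub_apply,
            triC_scalar_sub_apply]
          have e : n + 2 - (i.val + 1 + 1) = n - i.val := by omega
          simp [Fin.succ_succAbove_succ, e]
        rw [h3, Matrix.submatrix_apply, triC_scalar_sub_apply]
        simp
      · intro j _
        rw [Matrix.submatrix_apply, triC_scalar_sub_apply]
        simp
    rw [h1, h2, triC_scalar_sub_apply, triC_scalar_sub_apply]
    simp
    ring
  · intro i _
    rw [triC_scalar_sub_apply]
    simp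

theorem triC_no_common (a b : ℕ → ℝ) (hb : ∀ k, 2 ≤ k → 0 < b k) (x : ℝ) (n : ℕ)
    (h0 : (triC a b n).charpoly.eval x = 0) :
    (triC a b (n + 1)).charpoly.eval x ≠ 0 := by
  induction n with
  | zero => simp [triC_charpoly_det] at h0
  | succ n ih =>
    intro h1
    rw [triC_rec, h0] at h1
    have hbn := hb (n + 2) (by omega)
    have h2 : (triC a b n).charpoly.eval x = 0 := by
      have : b (n + 2) * (triC a b n).charpoly.eval x = 0 := by linarith
      exact (mul_eq_zero.mp this).resolve_left hbn.ne'
    exact ih h2 h0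

/-- (Lemma 4.1(2)) For the recursively defined tridiagonal matrices `C_n`,
if `k ≥ 3` and `α` is an eigenvalue of `C_{k-2}`, then `α` is an eigenvalue of `C_k`
if and only if `a_k = α`. -/
theorem triC_eig_two_step (a b : ℕ → ℝ) (hb : ∀ k, 2 ≤ k → 0 < b k)
    (k : ℕ) (hk : 3 ≤ k) (α : ℝ)
    (hα : (triC a b (k - 2)).charpoly.IsRoot α) :
    (triC a b k).charpoly.IsRoot α ↔ a k = α := by
  obtain ⟨n, rfl⟩ : ∃ n, k = n + 2 := ⟨k - 2, by omega⟩
  have h0 : (triC a b n).charpoly.eval α = 0 := hα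
  have h1 := triC_no_common a b hb α n h0
  rw [Polynomial.IsRoot.def, triC_rec, h0, mul_zero, sub_zero, mul_eq_zero]
  constructor
  · intro h
    linarith [h.resolve_right h1]
  · intro h
    left
    linarith
end

section
/- For the recursively defined tridiagonal matrices C_n, if k ≥ 4 and β is an eigenvalue of C_{k−3}, then β is an eigenvalue of C_k if and only if b_k = (β − a_k)(β − a_{k−1}). -/
/-- The value of the characteristic polynomial as a determinant. -/
noncomputable def triP (a b : ℕ → ℝ) (x : ℝ) (n : ℕ) : ℝ :=
  (Matrix.of fun j k : Fin n =>
    if j.val = k.val then x - a (n - j.val)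
    else if j.val + 1 = k.val then - b (n - j.val)
    else if k.val + 1 = j.val then -1
    else 0 : Matrix (Fin n) (Fin n) ℝ).det

theorem triP_eq (a b : ℕ → ℝ) (x : ℝ) (n : ℕ) :
    (triC a b n).charpoly.eval x = triP a b x n := by
  rw [Matrix.eval_charpoly, triP]
  congr 1
  ext i j
  simp only [Matrix.sub_apply, Matrix.scalar_apply, Matrix.diagonal_apply, triC, Matrix.of_apply,
    Fin.ext_iff]
  split_ifs <;> simp

theorem triP_rec (a b : ℕ → ℝ) (x : ℝ) (n : ℕ) :
    triP a b x (n + 2) = (x - a (n + 2)) * triP a b x (n + 1) - b (n + 2) * triP a b x n := by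
  conv_lhs => rw [triP, Matrix.det_succ_row_zero, Fin.sum_univ_succ, Fin.sum_univ_succ]
  rw [Finset.sum_eq_zero]
  · conv_lhs =>
      enter [2, 1, 2]
      rw [Matrix.det_succ_column_zero, Fin.sum_univ_succ]
    rw [Finset.sum_eq_zero]
    · simp only [triP]
      simp [Matrix.submatrix]
      exact (sub_eq_add_neg _ _).symm
    · intro i _
      simp
  · intro i _
    simp

/-- (Lemma 4.1(3)) For the recursively defined tridiagonal matrices `C_n`,
if `k ≥ 4` and `β` is an eigenvalue of `C_{k-3}`, then `β` is an eigenvalue of `C_k`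
if and only if `b_k = (β - a_k)(β - a_{k-1})`. -/
theorem triC_eig_three_step (a b : ℕ → ℝ) (hb : ∀ k, 2 ≤ k → 0 < b k)
    (k : ℕ) (hk : 4 ≤ k) (β : ℝ)
    (hβ : (triC a b (k - 3)).charpoly.IsRoot β) :
    (triC a b k).charpoly.IsRoot β ↔ b k = (β - a k) * (β - a (k - 1)) := by
  obtain ⟨m, rfl⟩ : ∃ m, k = m + 4 := ⟨k - 4, by omega⟩
  have hne : ∀ n, ¬ (triP a b β n = 0 ∧ triP a b β (n + 1) = 0) := by
    intro n
    induction n with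
    | zero => rintro ⟨h, -⟩; simp [triP] at h
    | succ n ih =>
      rintro ⟨h1, h2⟩
      rw [triP_rec, h1] at h2
      have := hb (n + 2) (by omega)
      refine ih ⟨?_, h1⟩
      simpa [this.ne'] using h2
  rw [Polynomial.IsRoot, triP_eq] at hβ ⊢
  have e1 : m + 4 - 3 = m + 1 := by omega
  have e2 : m + 4 - 1 = m + 3 := by omega
  rw [e1] at hβ
  rw [e2]
  have h2 : triP a b β (m + 2) ≠ 0 := fun h => hne (m + 1) ⟨hβ, h⟩
  have h3 := triP_rec a b β (m + 1)
  have h4 := triP_rec a b β (m + 2)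
  have h5 : triP a b β (m + 4) =
      ((β - a (m + 4)) * (β - a (m + 3)) - b (m + 4)) * triP a b β (m + 2) := by
    rw [h4, h3, hβ]; ring
  rw [h5, mul_eq_zero, or_iff_left h2, sub_eq_zero, eq_comm]
end

section
/- (Invertible Subtrees Lemma) Let T be a forest, A ∈ R(T), c ≥ 1, and let T_1, …, T_c be mutually independent subtrees of T such that each principal submatrix A[T_i] is invertible. Then the nullity of A is at most the path cover number P(T ∖ (T_1 ∪ … ∪ T_c)). -/
/-- `S` is the vertex set of a nonempty induced path of `G` (listed in path order by `f`). -/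
def IsInducedPathOn {V : Type*} [DecidableEq V] (G : SimpleGraph V) (S : Finset V) : Prop :=
  ∃ (n : ℕ) (f : Fin n → V), 0 < n ∧ Function.Injective f ∧
    Finset.image f Finset.univ = S ∧
    ∀ i j : Fin n, G.Adj (f i) (f j) ↔ (i.val + 1 = j.val ∨ j.val + 1 = i.val)

/-- `C` is a path cover of the induced subgraph of `G` on the vertex set `W`: a collection
of vertex-disjoint induced paths whose vertex union is `W`. -/
def IsPathCoverOn {V : Type*} [DecidableEq V] (G : SimpleGraph V) (W : Finset V)
    (C : Finset (Finset V)) : Prop :=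
  (∀ S ∈ C, S ⊆ W ∧ IsInducedPathOn G S) ∧
  ∀ v ∈ W, ∃! S, S ∈ C ∧ v ∈ S

/-- The path cover number of the induced subgraph of `G` on the vertex set `W`. -/
noncomputable def pathCoverNumber {V : Type*} [DecidableEq V] (G : SimpleGraph V)
    (W : Finset V) : ℕ :=
  sInf {k | ∃ C : Finset (Finset V), IsPathCoverOn G W C ∧ C.card = k}

/-- Cutting the cross edges of a forest one at a time. -/
theorem cut_cross_edges {V ι : Type*} [Fintype V] [DecidableEq V]
    (b : V → ι) (U D : Set V) (A₀ : Matrix V V ℝ)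
    (hU : ∀ u w, u ∈ U → w ∈ U → b u = b w)
    (hbase : ∀ (A : Matrix V V ℝ) (x : V → ℝ),
      (∀ v w, b v ≠ b w → A v w = 0) →
      (∀ v w, v ≠ w → b v = b w → A v w = A₀ v w) →
      (∀ v ∈ U, A v v = A₀ v v) → A.mulVec x = 0 → (∀ v ∈ D, x v = 0) → x = 0) :
    ∀ (k : ℕ) (T : SimpleGraph V), T.edgeSet.ncard = k → T.IsAcyclic →
      ∀ (A : Matrix V V ℝ) (x : V → ℝ),
      (∀ v w, v ≠ w → ¬ T.Adj v w → A v w = 0) →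
      (∀ v w, v ≠ w → b v = b w → A v w = A₀ v w) →
      (∀ v ∈ U, A v v = A₀ v v) → A.mulVec x = 0 → (∀ v ∈ D, x v = 0) → x = 0 := by
  classical
  intro k
  induction k using Nat.strong_induction_on with
  | _ k ih =>
  intro T hk hT A x hpat hsame hdiag hx hD
  by_cases hcross : ∃ u w, T.Adj u w ∧ b u ≠ b w
  swap
  · push Not at hcross
    refine hbase A x ?_ hsame hdiag hx hD
    intro v w hvw
    exact hpat v w (fun h => hvw (by rw [h])) (fun h => hvw (hcross v w h))
  obtain ⟨u, w, huw, hb, hw⟩ : ∃ u w, T.Adj u w ∧ b u ≠ b w ∧ w ∉ U := by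
    obtain ⟨u, w, h1, h2⟩ := hcross
    by_cases hw : w ∈ U
    · exact ⟨w, u, h1.symm, h2.symm, fun hu => h2 (hU u w hu hw)⟩
    · exact ⟨u, w, h1, h2, hw⟩
  have hne : u ≠ w := huw.ne
  set T' : SimpleGraph V := T.deleteEdges {s(u, w)} with hT'
  have hT'adj : ∀ v t, T'.Adj v t ↔ T.Adj v t ∧ ¬ ((v = u ∧ t = w) ∨ (v = w ∧ t = u)) := by
    intro v t
    simp [hT', SimpleGraph.deleteEdges_adj]
  have hle : T' ≤ T := SimpleGraph.deleteEdges_le _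
  have hT'ac : T'.IsAcyclic := hT.anti hle
  have hcard : T'.edgeSet.ncard < k := by
    rw [← hk]
    apply Set.ncard_lt_ncard _ (Set.toFinite _)
    refine ⟨SimpleGraph.edgeSet_mono hle, fun h => ?_⟩
    have h1 : s(u, w) ∈ T'.edgeSet := h huw
    rw [SimpleGraph.mem_edgeSet, hT'adj] at h1
    exact h1.2 (Or.inl ⟨rfl, rfl⟩)
  have hnr : ¬ T'.Reachable w u := by
    have h1 : T.IsBridge s(u, w) := SimpleGraph.isAcyclic_iff_forall_edge_isBridge.mp hT huw
    rw [SimpleGraph.isBridge_iff] at h1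
    intro h
    exact h1 h.symm
  have IH := ih _ hcard T' rfl hT'ac
  let A' : Matrix V V ℝ := fun v t => if (v = u ∧ t = w) ∨ (v = w ∧ t = u) then 0 else A v t
  have hA'def : ∀ v t, A' v t = if (v = u ∧ t = w) ∨ (v = w ∧ t = u) then 0 else A v t :=
    fun _ _ => rfl
  have hA'pat : ∀ v t, v ≠ t → ¬ T'.Adj v t → A' v t = 0 := by
    intro v t hvt h
    rw [hA'def]
    split_ifs with h1
    · rfl
    · exact hpat v t hvt (fun h2 => h ((hT'adj v t).2 ⟨h2, h1⟩))
  have hA'same : ∀ v t, v ≠ t → b v = b t → A' v t = A₀ v t := by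
    intro v t hvt h
    rw [hA'def, if_neg, hsame v t hvt h]
    rintro (⟨rfl, rfl⟩ | ⟨rfl, rfl⟩)
    · exact hb h
    · exact hb h.symm
  have hA'd : ∀ v, A' v v = A v v := by
    intro v
    rw [hA'def, if_neg]
    rintro (⟨rfl, h⟩ | ⟨rfl, h⟩)
    · exact hne h
    · exact hne h.symm
  have hrow : ∀ v, ∑ t, A v t * x t = 0 := fun v => congrFun hx v
  have hrow' : ∀ v, v ≠ u → v ≠ w → ∑ t, A' v t * x t = 0 := by
    intro v h1 h2
    rw [← hrow v]
    refine Finset.sum_congr rfl fun t _ => ?_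
    rw [hA'def, if_neg (by tauto)]
  have hroww : ∑ t, A' w t * x t = - (A w u * x u) := by
    have h1 : ∑ t, (A w t * x t - A' w t * x t) = A w u * x u := by
      rw [Finset.sum_eq_single u]
      · rw [hA'def, if_pos (by tauto)]; ring
      · intro t _ ht
        rw [hA'def, if_neg (by tauto)]; ring
      · simp
    rw [Finset.sum_sub_distrib, hrow w] at h1
    linarith
  have hrowu : ∑ t, A' u t * x t = - (A u w * x w) := by
    have h1 : ∑ t, (A u t * x t - A' u t * x t) = A u w * x w := by
      rw [Finset.sum_eq_single w]
      · rw [hA'def, if_pos (by tauto)]; ring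
      · intro t _ ht
        rw [hA'def, if_neg (by tauto)]; ring
      · simp
    rw [Finset.sum_sub_distrib, hrow u] at h1
    linarith
  have hcut : ∀ v t, A' v t ≠ 0 → (T'.Reachable w v ↔ T'.Reachable w t) := by
    intro v t h
    by_cases hvt : v = t
    · rw [hvt]
    · have h1 : T'.Adj v t := by
        by_contra h2
        exact h (hA'pat v t hvt h2)
      exact ⟨fun h => h.trans h1.reachable, fun h => h.trans h1.symm.reachable⟩
  let y : V → ℝ := fun v => if T'.Reachable w v then x v else 0
  let z : V → ℝ := fun v => if T'.Reachable w v then 0 else x v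
  have hy : ∀ v, ∑ t, A' v t * y t = if T'.Reachable w v then ∑ t, A' v t * x t else 0 := by
    intro v
    split_ifs with h
    · refine Finset.sum_congr rfl fun t _ => ?_
      by_cases h0 : A' v t = 0
      · simp [h0]
      · simp only [y]; rw [if_pos ((hcut v t h0).1 h)]
    · refine Finset.sum_eq_zero fun t _ => ?_
      by_cases h0 : A' v t = 0
      · simp [h0]
      · simp only [y]; rw [if_neg (fun h2 => h ((hcut v t h0).2 h2)), mul_zero]
  have hz : ∀ v, ∑ t, A' v t * z t = if T'.Reachable w v then 0 else ∑ t, A' v t * x t := by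
    intro v
    split_ifs with h
    · refine Finset.sum_eq_zero fun t _ => ?_
      by_cases h0 : A' v t = 0
      · simp [h0]
      · simp only [z]; rw [if_pos ((hcut v t h0).1 h), mul_zero]
    · refine Finset.sum_congr rfl fun t _ => ?_
      by_cases h0 : A' v t = 0
      · simp [h0]
      · simp only [z]; rw [if_neg (fun h2 => h ((hcut v t h0).2 h2))]
  have hxw : x w = 0 := by
    by_contra hxw
    let c : ℝ := A w u * x u / x w
    let A'' : Matrix V V ℝ := fun v t => A' v t + if v = w ∧ t = w then c else 0
    have hA''def : ∀ v t, A'' v t = A' v t + if v = w ∧ t = w then c else 0 := fun _ _ => rfl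
    have hy0 : y = 0 := by
      refine IH A'' y ?_ ?_ ?_ ?_ ?_
      · intro v t hvt h
        rw [hA''def, hA'pat v t hvt h, if_neg, add_zero]
        rintro ⟨rfl, rfl⟩; exact hvt rfl
      · intro v t hvt h
        rw [hA''def, hA'same v t hvt h, if_neg, add_zero]
        rintro ⟨rfl, rfl⟩; exact hvt rfl
      · intro v hv
        rw [hA''def, hA'd, hdiag v hv, if_neg, add_zero]
        rintro ⟨rfl, -⟩; exact hw hv
      · funext v
        change ∑ t, A'' v t * y t = 0
        have h1 : ∑ t, A'' v t * y t = ∑ t, A' v t * y t + if v = w then c * y w else 0 := by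
          simp only [hA''def, add_mul, Finset.sum_add_distrib]
          congr 1
          by_cases hvw : v = w
          · simp [hvw]
          · simp [hvw]
        rw [h1, hy]
        by_cases hvw : v = w
        · subst hvw
          have hyv : y v = x v := by simp [y]
          rw [if_pos (SimpleGraph.Reachable.refl _), if_pos rfl, hroww, hyv]
          simp only [c]
          field_simp
          ring
        · rw [if_neg hvw, add_zero]
          split_ifs with h
          · refine hrow' v ?_ hvw
            rintro rfl; exact hnr h
          · rfl
      · intro v hv
        simp [y, hD v hv]
    have h2 := congrFun hy0 w
    simp [y] at h2
    exact hxw h2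
  have hxu : x u = 0 := by
    have hz0 : z = 0 := by
      refine IH A' z hA'pat hA'same (fun v hv => by rw [hA'd, hdiag v hv]) ?_ ?_
      · funext v
        change ∑ t, A' v t * z t = 0
        rw [hz]
        split_ifs with h
        · rfl
        · by_cases hvu : v = u
          · rw [hvu, hrowu, hxw]; simp
          · refine hrow' v hvu ?_
            rintro rfl; exact h (SimpleGraph.Reachable.refl _)
      · intro v hv
        simp [z, hD v hv]
    have h2 := congrFun hz0 u
    simpa [z, hnr] using h2
  refine IH A' x hA'pat hA'same (fun v hv => by rw [hA'd, hdiag v hv]) ?_ hD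
  funext v
  change ∑ t, A' v t * x t = 0
  by_cases hvu : v = u
  · rw [hvu, hrowu, hxw]; simp
  · by_cases hvw : v = w
    · rw [hvw, hroww, hxu]; simp
    · exact hrow' v hvu hvw

theorem exists_pathCover {V : Type*} [DecidableEq V] (G : SimpleGraph V) (W : Finset V) :
    ∃ C : Finset (Finset V), IsPathCoverOn G W C := by
  refine ⟨W.image (fun v => {v}), ?_, ?_⟩
  · intro S hS
    obtain ⟨v, hv, rfl⟩ := Finset.mem_image.1 hS
    refine ⟨by simpa using hv, 1, fun _ => v, one_pos, fun _ _ _ => Subsingleton.elim _ _, ?_, ?_⟩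
    · simp
    · intro i j
      simp
  · intro v hv
    refine ⟨{v}, ⟨Finset.mem_image_of_mem _ hv, by simp⟩, ?_⟩
    rintro S ⟨hS, hvS⟩
    obtain ⟨w, hw, rfl⟩ := Finset.mem_image.1 hS
    simp at hvS
    rw [hvS]

/-- (Invertible Subtrees Lemma, Lemma 5.5) Let `T` be a forest,
`A ∈ 𝓡(T)`, `c ≥ 1`, and `T_1, …, T_c` mutually independent subtrees of `T` with each
`A[T_i]` invertible.  Then the nullity of `A` is at most the path cover number of
`T ∖ (T_1 ∪ ⋯ ∪ T_c)`. -/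
theorem invertible_subtrees_lemma {V : Type*} [Fintype V] [DecidableEq V]
    (T : SimpleGraph V) (hT : T.IsAcyclic)
    (A : Matrix V V ℝ) (hA : MatrRG T A)
    (c : ℕ) (hc : 1 ≤ c) (S : Fin c → Finset V)
    (hsub : ∀ i, (T.induce ((S i : Finset V) : Set V)).Connected)
    (hindep : ∀ i j, i ≠ j → ∀ u ∈ S i, ∀ w ∈ S j, ¬T.Adj u w)
    (hinv : ∀ i, IsUnit (A.submatrix
      (fun x : {x // x ∈ S i} => (x : V)) (fun x : {x // x ∈ S i} => (x : V)))) :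
    Module.finrank ℝ (LinearMap.ker A.mulVecLin)
      ≤ pathCoverNumber T (Finset.univ \ Finset.univ.biUnion S) := by
  classical
  have hex : {k | ∃ C : Finset (Finset V), IsPathCoverOn T
      (Finset.univ \ Finset.univ.biUnion S) C ∧ C.card = k}.Nonempty := by
    obtain ⟨C, hC⟩ := exists_pathCover T (Finset.univ \ Finset.univ.biUnion S)
    exact ⟨_, C, hC, rfl⟩
  obtain ⟨C, hC, hcard⟩ := Nat.sInf_mem hex
  unfold pathCoverNumber
  rw [← hcard]
  obtain ⟨hC1, hC2⟩ := hC
  choose hCW hpath using hC1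
  choose n f hpos hinj himg hadj using hpath
  let U : Set V := {v | ∃ i, v ∈ S i}
  have hUmem : ∀ v, v ∈ Finset.univ \ Finset.univ.biUnion S ↔ v ∉ U := by
    intro v; simp [U]
  let b : V → Option (Finset V) := fun v =>
    if h : v ∈ U then none else some (hC2 v ((hUmem v).2 h)).choose
  have hbU : ∀ v, v ∈ U → b v = none := fun v hv => dif_pos hv
  have hbP : ∀ v, v ∉ U → ∀ P, P ∈ C → (v ∈ P ↔ b v = some P) := by
    intro v hv P hP
    have h1 := (hC2 v ((hUmem v).2 hv)).choose_spec
    have h2 : b v = some (hC2 v ((hUmem v).2 hv)).choose := dif_neg hv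
    rw [h2]
    constructor
    · intro h
      rw [h1.2 P ⟨hP, h⟩]
    · intro h
      rw [← Option.some.inj h]
      exact h1.1.2
  let D : Set V := {v | ∃ (P : Finset V) (hP : P ∈ C), v = f P hP ⟨0, hpos P hP⟩}
  have hA0 : ∀ v w, v ≠ w → ¬ T.Adj v w → A v w = 0 := by
    intro v w hvw h
    by_contra h1
    exact h ((hA.1 v w hvw).1 h1)
  have hbase : ∀ (B : Matrix V V ℝ) (x : V → ℝ),
      (∀ v w, b v ≠ b w → B v w = 0) →
      (∀ v w, v ≠ w → b v = b w → B v w = A v w) →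
      (∀ v ∈ U, B v v = A v v) → B.mulVec x = 0 → (∀ v ∈ D, x v = 0) → x = 0 := by
    intro B x hcr hsame hdiag hx hD
    have hrow : ∀ v, ∑ t, B v t * x t = 0 := fun v => congrFun hx v
    funext v
    change x v = 0
    by_cases hv : v ∈ U
    · obtain ⟨i, hi⟩ := hv
      have hk : (A.submatrix (fun x : {x // x ∈ S i} => (x : V))
          (fun x : {x // x ∈ S i} => (x : V))).mulVec (fun s => x s) = 0 := by
        funext s
        change ∑ t : {x // x ∈ S i}, A s t * x t = 0
        have hsU : (s : V) ∈ U := ⟨i, s.2⟩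
        rw [← hrow s, Finset.sum_coe_sort (S i) (fun t => A s t * x t)]
        rw [← Finset.sum_subset (Finset.subset_univ (S i))]
        · refine Finset.sum_congr rfl fun t ht => ?_
          have htU : t ∈ U := ⟨i, ht⟩
          by_cases hst : (s : V) = t
          · rw [← hst, hdiag _ hsU]
          · rw [hsame _ _ hst (by rw [hbU _ hsU, hbU _ htU])]
        · intro t _ ht
          have hst : (s : V) ≠ t := by
            intro h; exact ht (h ▸ s.2)
          by_cases htU : t ∈ U
          · rw [hsame _ _ hst (by rw [hbU _ hsU, hbU _ htU])]
            obtain ⟨j, hj⟩ := htU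
            have hij : i ≠ j := by
              rintro rfl; exact ht hj
            rw [hA0 _ _ hst (hindep i j hij _ s.2 _ hj), zero_mul]
          · rw [hcr, zero_mul]
            rw [hbU _ hsU]
            simp [b, htU]
      have h0 := Matrix.mulVec_injective_of_isUnit (hinv i) (hk.trans (Matrix.mulVec_zero _).symm)
      exact congrFun h0 ⟨v, hi⟩
    · obtain ⟨P, ⟨hP, hvP⟩, -⟩ := hC2 v ((hUmem v).2 hv)
      have hfP : ∀ i, f P hP i ∈ P := by
        intro i
        have h1 := Finset.mem_image_of_mem (f P hP) (Finset.mem_univ i)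
        rwa [himg P hP] at h1
      have hfU : ∀ i, f P hP i ∉ U := fun i => (hUmem _).1 (hCW P hP (hfP i))
      have hfb : ∀ i, b (f P hP i) = some P := fun i => (hbP _ (hfU i) P hP).1 (hfP i)
      have key : ∀ (i : ℕ) (hi : i < n P hP), x (f P hP ⟨i, hi⟩) = 0 := by
        intro i
        induction i using Nat.strong_induction_on with
        | _ i ih =>
        intro hi
        rcases i with _ | k
        · exact hD _ ⟨P, hP, rfl⟩
        · have hk : k < n P hP := by omega
          have hne : f P hP ⟨k, hk⟩ ≠ f P hP ⟨k + 1, hi⟩ := by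
            intro h
            have := hinj P hP h
            simp at this
          have h1 := hrow (f P hP ⟨k, hk⟩)
          rw [Finset.sum_eq_single (f P hP ⟨k + 1, hi⟩)] at h1
          · have hAd : T.Adj (f P hP ⟨k, hk⟩) (f P hP ⟨k + 1, hi⟩) :=
              (hadj P hP _ _).2 (Or.inl rfl)
            rw [hsame _ _ hne (by rw [hfb, hfb])] at h1
            exact (mul_eq_zero.1 h1).resolve_left ((hA.1 _ _ hne).2 hAd)
          · intro t _ ht
            by_cases htb : b t = some P
            · have htU : t ∉ U := by
                intro h; rw [hbU t h] at htb; cases htb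
              have htP : t ∈ P := (hbP t htU P hP).2 htb
              rw [← himg P hP] at htP
              obtain ⟨j, -, rfl⟩ := Finset.mem_image.1 htP
              by_cases hj : j.val ≤ k
              · rw [ih j.val (by omega) j.2, mul_zero]
              · have hjk : j.val ≠ k + 1 := by
                  intro h
                  apply ht
                  congr 1
                  exact Fin.ext h
                rw [hsame _ _ _ (by rw [hfb, hfb]), hA0, zero_mul]
                · intro h
                  have := hinj P hP h
                  rw [← this] at hj
                  exact hj le_rfl
                · rw [hadj]
                  simp only
                  omega
                · intro h
                  have := hinj P hP h
                  rw [← this] at hj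
                  exact hj le_rfl
            · rw [hcr, zero_mul]
              rw [hfb]; exact fun h => htb h.symm
          · simp
      rw [← himg P hP] at hvP
      obtain ⟨j, -, rfl⟩ := Finset.mem_image.1 hvP
      exact key j.val j.2
  have main := cut_cross_edges b U D A (fun u w hu hw => by rw [hbU u hu, hbU w hw]) hbase
    _ T rfl hT A
  let L : LinearMap.ker A.mulVecLin →ₗ[ℝ] ({P // P ∈ C} → ℝ) :=
    { toFun := fun x P => (x : V → ℝ) (f P.1 P.2 ⟨0, hpos P.1 P.2⟩)
      map_add' := fun _ _ => rfl
      map_smul' := fun _ _ => rfl }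
  have hL : Function.Injective L := by
    rw [injective_iff_map_eq_zero]
    intro x hx
    apply Subtype.ext
    refine main x.1 hA0 (fun _ _ _ _ => rfl) (fun _ _ => rfl) x.2 ?_
    rintro v ⟨P, hP, rfl⟩
    exact congrFun hx ⟨P, hP⟩
  have h := LinearMap.finrank_le_finrank_of_injective hL
  simpa using h
end

section
/- Let T be a tree, A ∈ R(T), and let T_1, …, T_c be mutually independent subtrees of T. (1) If nullity(A) > P(T ∖ (T_1 ∪ … ∪ T_c)), then at least one of the principal submatrices A[T_1], …, A[T_c] is not invertible. (2) If λ is an eigenvalue of A with mult(λ, A) > P(T ∖ (T_1 ∪ … ∪ T_c)), then λ is an eigenvalue of at least one of A[T_1], …, A[T_c]. -/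
open SimpleGraph in
/-- In a tree rooted at `r`, parents are unique. -/
theorem tree_parent_unique {V : Type*} {T : SimpleGraph V} (hT : T.IsTree) (r : V) {v w w' : V}
    (h : T.Adj w v) (h' : T.Adj w' v) (hd : T.dist r v = T.dist r w + 1)
    (hd' : T.dist r v = T.dist r w' + 1) : w = w' := by
  obtain ⟨q, hq⟩ := hT.connected.exists_walk_length_eq_dist r w
  obtain ⟨q', hq'⟩ := hT.connected.exists_walk_length_eq_dist r w'
  have h1 : (q.concat h).IsPath := Walk.isPath_of_length_eq_dist _ (by simp [hq, hd])
  have h2 : (q'.concat h').IsPath := Walk.isPath_of_length_eq_dist _ (by simp [hq', hd'])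
  have h3 := congrArg Subtype.val (hT.isAcyclic.path_unique ⟨_, h1⟩ ⟨_, h2⟩)
  have h4 := congrArg Walk.penultimate h3
  simpa using h4

theorem tree_no_nonbacktracking {V : Type*} [Finite V] {T : SimpleGraph V} (hT : T.IsTree)
    (U : Set V) (hU : U.Nonempty) (f : V → V)
    (hf : ∀ y ∈ U, f y ∈ U ∧ T.Adj y (f y) ∧ f (f y) ≠ y) : False := by
  have hU' := hU
  obtain ⟨r, -⟩ := hU'
  by_cases hB : ({y ∈ U | T.dist r (f y) = T.dist r y + 1} : Set V).Nonempty
  · obtain ⟨y, hy, hmax⟩ := Set.exists_max_image _ (fun y => T.dist r y) (Set.toFinite _) hB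
    obtain ⟨h1, h2, h3⟩ := hf y hy.1
    obtain ⟨h4, h5, h6⟩ := hf _ h1
    have hyd := hy.2
    rcases hT.dist_eq_dist_add_one_of_adj r h5 with h | h
    · exact h3 (tree_parent_unique hT r h5.symm h2 h hy.2)
    · have := hmax (f y) ⟨h1, h⟩
      omega
  · obtain ⟨y, hy, hmin⟩ := Set.exists_min_image U (fun y => T.dist r y) (Set.toFinite _) hU
    obtain ⟨h1, h2, h3⟩ := hf y hy
    have := hmin _ h1
    rcases hT.dist_eq_dist_add_one_of_adj r h2 with h | h
    · omega
    · exact hB ⟨y, hy, h⟩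

theorem connected_step {V : Type*} {T : SimpleGraph V} (K : Finset V)
    (hK : (T.induce (K : Set V)).Connected) (b : V) (hb : b ∈ K) :
    ∃ (g : V → V) (d : V → ℕ), ∀ y ∈ K, y ≠ b → g y ∈ K ∧ T.Adj y (g y) ∧ d (g y) < d y := by
  classical
  let d : V → ℕ := fun y => if h : y ∈ K then
    (T.induce (K : Set V)).dist ⟨y, by simpa using h⟩ ⟨b, by simpa using hb⟩ else 0
  have key : ∀ y, ∃ z, y ∈ K → y ≠ b → z ∈ K ∧ T.Adj y z ∧ d z < d y := by
    intro y
    by_cases h : y ∈ K ∧ y ≠ b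
    · obtain ⟨hy, hyb⟩ := h
      obtain ⟨p, hp⟩ := hK.exists_walk_length_eq_dist ⟨y, by simpa using hy⟩ ⟨b, by simpa using hb⟩
      cases p with
      | nil => exact absurd rfl hyb
      | @cons _ z _ hadj q =>
        refine ⟨z.1, fun _ _ => ⟨by simpa using z.2, hadj, ?_⟩⟩
        have hz : z.1 ∈ K := by simpa using z.2
        have := SimpleGraph.dist_le q
        simp only [d, hz, hy, dif_pos]
        rw [← hp]
        simp only [SimpleGraph.Walk.length_cons]
        exact Nat.lt_succ_of_le this
    · exact ⟨y, fun h1 h2 => absurd ⟨h1, h2⟩ h⟩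
  choose g hg using key
  exact ⟨g, d, hg⟩

theorem core_forcing {V : Type*} [Finite V] {T : SimpleGraph V} (hT : T.IsTree) (x : V → ℝ)
    (blk : V → Finset V) (hmem : ∀ v, v ∈ blk v) (hblk : ∀ v, ∀ w ∈ blk v, blk w = blk v)
    (hconn : ∀ v, (T.induce (blk v : Set V)).Connected) (isP : Finset V → Prop)
    (exitP : ∀ v, isP (blk v) → x v ≠ 0 →
      ∃ b ∈ blk v, ∃ u, u ∉ blk v ∧ T.Adj b u ∧ x u ≠ 0 ∧ x b = 0)
    (exitS : ∀ v, ¬ isP (blk v) → x v ≠ 0 → ∃ b ∈ blk v, ∃ u, u ∉ blk v ∧ T.Adj b u ∧ x u ≠ 0)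
    (indep : ∀ b u, T.Adj b u → ¬ isP (blk b) → ¬ isP (blk u) → blk b = blk u) : x = 0 := by
  classical
  by_contra hx
  obtain ⟨v0, hv0⟩ : ∃ v, x v ≠ 0 := by
    by_contra h
    push Not at h
    exact hx (funext h)
  have key : ∀ K : Finset V, ∃ (b u : V) (g : V → V) (d : V → ℕ), (∃ v, blk v = K ∧ x v ≠ 0) →
      b ∈ K ∧ u ∉ K ∧ T.Adj b u ∧ x u ≠ 0 ∧ (isP K → x b = 0) ∧
      ∀ y ∈ K, y ≠ b → g y ∈ K ∧ T.Adj y (g y) ∧ d (g y) < d y := by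
    intro K
    by_cases hK : ∃ v, blk v = K ∧ x v ≠ 0
    · obtain ⟨v, rfl, hv⟩ := hK
      by_cases hP : isP (blk v)
      · obtain ⟨b, hb, u, hu, h1, h2, h3⟩ := exitP v hP hv
        obtain ⟨g, d, hgd⟩ := connected_step (blk v) (hconn v) b hb
        exact ⟨b, u, g, d, fun _ => ⟨hb, hu, h1, h2, fun _ => h3, hgd⟩⟩
      · obtain ⟨b, hb, u, hu, h1, h2⟩ := exitS v hP hv
        obtain ⟨g, d, hgd⟩ := connected_step (blk v) (hconn v) b hb
        exact ⟨b, u, g, d, fun _ => ⟨hb, hu, h1, h2, fun h => absurd h hP, hgd⟩⟩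
    · exact ⟨v0, v0, id, fun _ => 0, fun h => absurd h hK⟩
  choose b u g d hkey using key
  let f : V → V := fun y => if y = b (blk y) then u (blk y) else g (blk y) y
  refine tree_no_nonbacktracking hT {y | ∃ v, blk v = blk y ∧ x v ≠ 0} ⟨v0, v0, rfl, hv0⟩ f ?_
  intro y hy
  obtain ⟨hb, hu, hadj, hxu, hxb, hg⟩ := hkey _ hy
  by_cases hyb : y = b (blk y)
  · have hfy : f y = u (blk y) := by simp only [f]; rw [if_pos hyb]
    have hfU : ∃ v, blk v = blk (u (blk y)) ∧ x v ≠ 0 := ⟨_, rfl, hxu⟩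
    rw [hfy]
    refine ⟨hfU, by rw [← hyb] at hadj; exact hadj, ?_⟩
    set w := u (blk y) with hw
    obtain ⟨hb', hu', hadj', hxu', hxb', hg'⟩ := hkey _ hfU
    by_cases hwb : w = b (blk w)
    · have hfw : f w = u (blk w) := by simp only [f]; rw [if_pos hwb]
      rw [hfw]
      intro hback
      rw [← hyb] at hxb hadj
      rw [← hwb] at hxb'
      rw [hback] at hxu'
      by_cases hP' : isP (blk w)
      · exact hxu (hxb' hP')
      · by_cases hP : isP (blk y)
        · exact hxu' (hxb hP)
        · have := indep _ _ hadj hP hP'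
          exact hu (this ▸ hmem w)
    · have hfw : f w = g (blk w) w := by simp only [f]; rw [if_neg hwb]
      rw [hfw]
      intro hback
      have h1 := (hg' w (hmem w) hwb).1
      rw [hback] at h1
      have := hblk _ _ h1
      exact hu (this ▸ hmem w)
  · have hfy : f y = g (blk y) y := by simp only [f]; rw [if_neg hyb]
    obtain ⟨h1, h2, h3⟩ := hg y (hmem y) hyb
    have hbe := hblk _ _ h1
    rw [hfy]
    refine ⟨by simpa [hbe] using hy, h2, ?_⟩
    by_cases hwb : g (blk y) y = b (blk y)
    · have : f (g (blk y) y) = u (blk y) := by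
        simp only [f]; rw [hbe, if_pos hwb]
      rw [this]
      intro h
      exact hu (h.symm ▸ hmem y)
    · have : f (g (blk y) y) = g (blk y) (g (blk y) y) := by
        simp only [f]; rw [hbe, if_neg hwb]
      rw [this]
      intro h
      have h4 := (hg _ h1 hwb).2.2
      rw [h] at h4
      omega

theorem exit_path {V : Type*} [Fintype V] [DecidableEq V] {T : SimpleGraph V} {A : Matrix V V ℝ}
    (hA : MatrRG T A) (x : V → ℝ) (hx : A.mulVec x = 0) (n : ℕ) (hn : 0 < n) (f : Fin n → V)
    (hadj : ∀ i j : Fin n, T.Adj (f i) (f j) ↔ (i.val + 1 = j.val ∨ j.val + 1 = i.val))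
    (h0 : x (f ⟨0, hn⟩) = 0) (i : Fin n) (hi : x (f i) ≠ 0) :
    ∃ b ∈ Finset.image f Finset.univ, ∃ u, u ∉ Finset.image f Finset.univ ∧ T.Adj b u ∧
      x u ≠ 0 ∧ x b = 0 := by
  obtain ⟨k, hk, hmin⟩ := Finset.exists_min_image (Finset.univ.filter fun i => x (f i) ≠ 0)
    (fun i => i.val) ⟨i, by simpa using hi⟩
  simp only [Finset.mem_filter, Finset.mem_univ, true_and] at hk hmin
  have hk0 : k.val ≠ 0 := by
    intro h
    have : k = ⟨0, hn⟩ := Fin.ext h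
    exact hk (this ▸ h0)
  have hz : ∀ j : Fin n, j.val < k.val → x (f j) = 0 := by
    intro j hj
    by_contra h
    have := hmin j h
    omega
  let j : Fin n := ⟨k.val - 1, by omega⟩
  have hj : j.val = k.val - 1 := rfl
  have hjk : T.Adj (f j) (f k) := (hadj j k).2 (Or.inl (by omega))
  have hxj : x (f j) = 0 := hz j (by omega)
  refine ⟨f j, by simp, ?_⟩
  by_contra hno
  push Not at hno
  have hrow : ∑ w, A (f j) w * x w = 0 := congrFun hx (f j)
  rw [Finset.sum_eq_single (f k)] at hrow
  · rcases mul_eq_zero.1 hrow with h | h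
    · exact ((hA.1 _ _ hjk.ne).2 hjk) h
    · exact hk h
  · intro w _ hw
    by_cases hwj : w = f j
    · rw [hwj, hxj, mul_zero]
    by_cases haw : T.Adj (f j) w
    · by_cases hwS : w ∈ Finset.image f Finset.univ
      · obtain ⟨l, -, rfl⟩ := Finset.mem_image.1 hwS
        have hl : l ≠ k := fun h => hw (h ▸ rfl)
        have hl' : l.val ≠ k.val := fun h => hl (Fin.ext h)
        have := (hadj j l).1 haw
        rw [hz l (by omega), mul_zero]
      · by_cases hxw : x w = 0
        · rw [hxw, mul_zero]
        · exact absurd hxj (hno w hwS haw hxw)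
    · have : A (f j) w = 0 := by
        by_contra h
        exact haw ((hA.1 _ _ (Ne.symm hwj)).1 h)
      rw [this, zero_mul]
  · simp

theorem exit_block {V : Type*} [Fintype V] [DecidableEq V] {T : SimpleGraph V} {A : Matrix V V ℝ}
    (hA : MatrRG T A) (x : V → ℝ) (hx : A.mulVec x = 0) (K : Finset V)
    (hK : IsUnit (A.submatrix (fun x : {x // x ∈ K} => (x : V)) (fun x : {x // x ∈ K} => (x : V))))
    (v : V) (hv : v ∈ K) (hxv : x v ≠ 0) :
    ∃ b ∈ K, ∃ u, u ∉ K ∧ T.Adj b u ∧ x u ≠ 0 := by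
  by_contra hno
  push Not at hno
  have hinj := Matrix.mulVec_injective_of_isUnit hK
  have : (fun s : {x // x ∈ K} => x s) = 0 := by
    apply hinj
    rw [Matrix.mulVec_zero]
    ext s
    have hrow : ∑ w, A s w * x w = 0 := congrFun hx s
    rw [← Finset.sum_subset (Finset.subset_univ K)] at hrow
    · rw [← Finset.sum_coe_sort] at hrow
      simpa [Matrix.mulVec, dotProduct] using hrow
    · intro w _ hw
      by_cases haw : T.Adj s w
      · rw [hno s s.2 w hw haw, mul_zero]
      · have hsw : (s : V) ≠ w := fun h => hw (h ▸ s.2)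
        have : A s w = 0 := by
          by_contra h
          exact haw ((hA.1 _ _ hsw).1 h)
        rw [this, zero_mul]
  exact hxv (congrFun this ⟨v, hv⟩)

theorem inducedPath_connected {V : Type*} [DecidableEq V] {T : SimpleGraph V} {K : Finset V}
    (h : IsInducedPathOn T K) : (T.induce (K : Set V)).Connected := by
  obtain ⟨n, f, hn, -, rfl, hadj⟩ := h
  have hm : ∀ i, f i ∈ ((Finset.image f Finset.univ : Finset V) : Set V) := by simp
  have hr : ∀ k (hk : k < n), (T.induce ((Finset.image f Finset.univ : Finset V) : Set V)).Reachable
      ⟨f ⟨0, hn⟩, hm _⟩ ⟨f ⟨k, hk⟩, hm _⟩ := by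
    intro k
    induction k with
    | zero => intro hk; exact SimpleGraph.Reachable.refl _
    | succ k ih =>
      intro hk
      refine (ih (by omega)).trans (SimpleGraph.Adj.reachable ?_)
      exact (hadj _ _).2 (Or.inl rfl)
  rw [SimpleGraph.connected_iff_exists_forall_reachable]
  refine ⟨⟨f ⟨0, hn⟩, hm _⟩, ?_⟩
  rintro ⟨w, hw⟩
  have hw' := hw
  simp only [Finset.coe_image, Finset.coe_univ, Set.image_univ, Set.mem_range] at hw'
  obtain ⟨i, rfl⟩ := hw'
  exact hr i.1 i.2

theorem nullity_le_of_cover {V : Type*} [Fintype V] [DecidableEq V]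
    (T : SimpleGraph V) (hT : T.IsTree) (A : Matrix V V ℝ) (hA : MatrRG T A)
    (c : ℕ) (S : Fin c → Finset V)
    (hsub : ∀ i, (T.induce ((S i : Finset V) : Set V)).Connected)
    (hindep : ∀ i j, i ≠ j → ∀ u ∈ S i, ∀ w ∈ S j, ¬T.Adj u w)
    (hunit : ∀ i, IsUnit (A.submatrix
        (fun x : {x // x ∈ S i} => (x : V)) (fun x : {x // x ∈ S i} => (x : V))))
    (C : Finset (Finset V))
    (hC : IsPathCoverOn T (Finset.univ \ Finset.univ.biUnion S) C) :
    Module.finrank ℝ (LinearMap.ker A.mulVecLin) ≤ C.card := by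
  classical
  have hst : ∀ P : C, ∃ s : V, ∃ (n : ℕ) (hn : 0 < n) (f : Fin n → V), s = f ⟨0, hn⟩ ∧
      Finset.image f Finset.univ = P.1 ∧
      ∀ i j : Fin n, T.Adj (f i) (f j) ↔ (i.val + 1 = j.val ∨ j.val + 1 = i.val) := by
    intro P
    obtain ⟨n, f, hn, -, him, hadj⟩ := (hC.1 P.1 P.2).2
    exact ⟨_, n, hn, f, rfl, him, hadj⟩
  choose s hs using hst
  -- distinct subtrees sharing a vertex coincide
  have hSS : ∀ i j v, v ∈ S i → v ∈ S j → S i = S j := by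
    intro i j v hi hj
    by_cases hij : i = j
    · rw [hij]
    have one : ∀ i j, i ≠ j → v ∈ S i → v ∈ S j → ∀ w ∈ S i, w = v := by
      intro i j hij hi hj w hw
      by_contra hne
      obtain ⟨g, d, hgd⟩ := connected_step (S i) (hsub i) w hw
      obtain ⟨h1, h2, -⟩ := hgd v hi (Ne.symm hne)
      exact hindep i j hij _ h1 _ hj h2.symm
    ext w
    constructor
    · intro hw
      rw [one i j hij hi hj w hw]; exact hj
    · intro hw
      rw [one j i (Ne.symm hij) hj hi w hw]; exact hi
  have hPW : ∀ P ∈ C, ∀ v ∈ P, ∀ i, v ∉ S i := by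
    intro P hP v hv i hi
    have := (hC.1 P hP).1 hv
    simp only [Finset.mem_sdiff, Finset.mem_univ, true_and, Finset.mem_biUnion, not_exists] at this
    exact this i hi
  have hdisj : ∀ K L : Finset V, (K ∈ C ∨ ∃ i, K = S i) → (L ∈ C ∨ ∃ i, L = S i) →
      ∀ v, v ∈ K → v ∈ L → K = L := by
    rintro K L (hK | ⟨i, rfl⟩) (hL | ⟨j, rfl⟩) v hvK hvL
    · exact (hC.2 v ((hC.1 K hK).1 hvK)).unique ⟨hK, hvK⟩ ⟨hL, hvL⟩
    · exact absurd hvL (hPW K hK v hvK j)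
    · exact absurd hvK (hPW L hL v hvL i)
    · exact hSS i j v hvK hvL
  have hex : ∀ v, ∃ K : Finset V, v ∈ K ∧ (K ∈ C ∨ ∃ i, K = S i) := by
    intro v
    by_cases h : ∃ i, v ∈ S i
    · obtain ⟨i, hi⟩ := h
      exact ⟨S i, hi, Or.inr ⟨i, rfl⟩⟩
    · obtain ⟨P, hP, -⟩ := hC.2 v (by simpa using h)
      exact ⟨P, hP.2, Or.inl hP.1⟩
  choose blk hmem hcase using hex
  have hforce : ∀ x : V → ℝ, A.mulVec x = 0 → (∀ P, x (s P) = 0) → x = 0 := by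
    intro x hx hxs
    refine core_forcing hT x blk hmem ?_ ?_ (fun K => K ∈ C) ?_ ?_ ?_
    · intro v w hw
      exact hdisj _ _ (hcase w) (hcase v) w (hmem w) hw
    · intro v
      rcases hcase v with h | ⟨i, h⟩
      · exact inducedPath_connected (hC.1 _ h).2
      · rw [h]; exact hsub i
    · intro v hP hv
      obtain ⟨n, hn, f, h0, him, hadj⟩ := hs ⟨blk v, hP⟩
      have hvm := hmem v
      simp only at him
      rw [← him] at hvm ⊢
      obtain ⟨i, -, rfl⟩ := Finset.mem_image.1 hvm
      exact exit_path hA x hx n hn f hadj (h0 ▸ hxs _) i hv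
    · intro v hP hv
      obtain ⟨i, hi⟩ := (hcase v).resolve_left hP
      have hvm := hmem v
      rw [hi] at hvm ⊢
      exact exit_block hA x hx (S i) (hunit i) v hvm hv
    · intro p q hpq hp hq
      obtain ⟨i, hi⟩ := (hcase p).resolve_left hp
      obtain ⟨j, hj⟩ := (hcase q).resolve_left hq
      by_cases hij : i = j
      · rw [hi, hj, hij]
      · exact absurd hpq (hindep i j hij p (hi ▸ hmem p) q (hj ▸ hmem q))
  let φ : LinearMap.ker A.mulVecLin →ₗ[ℝ] (C → ℝ) :=
    (LinearMap.funLeft ℝ ℝ s).comp (LinearMap.ker A.mulVecLin).subtype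
  have hφ : Function.Injective φ := by
    rw [← LinearMap.ker_eq_bot, LinearMap.ker_eq_bot']
    rintro ⟨x, hx⟩ hm
    have := hforce x (by simpa using hx) (fun P => congrFun hm P)
    exact Subtype.ext this
  have := LinearMap.finrank_le_finrank_of_injective hφ
  simpa using this

theorem pathCover_exists {V : Type*} [DecidableEq V] (T : SimpleGraph V) (W : Finset V) :
    ∃ C : Finset (Finset V), IsPathCoverOn T W C ∧ C.card = pathCoverNumber T W := by
  have : {k | ∃ C : Finset (Finset V), IsPathCoverOn T W C ∧ C.card = k}.Nonempty := by
    refine ⟨_, W.image (fun v => {v}), ⟨?_, ?_⟩, rfl⟩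
    · intro P hP
      obtain ⟨v, hv, rfl⟩ := Finset.mem_image.1 hP
      refine ⟨by simpa using hv, 1, fun _ => v, one_pos, fun _ _ _ => Subsingleton.elim _ _,
        by ext; simp [eq_comm], ?_⟩
      intro i j
      simp
    · intro v hv
      refine ⟨{v}, ⟨Finset.mem_image_of_mem _ hv, by simp⟩, ?_⟩
      rintro P ⟨hP, hvP⟩
      obtain ⟨w, hw, rfl⟩ := Finset.mem_image.1 hP
      simp only [Finset.mem_singleton] at hvP
      rw [hvP]
  exact Nat.sInf_mem this

/-- A matrix in `R(T)` is symmetrized by a positive diagonal matrix. -/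
theorem exists_symmetrizer {V : Type*} {T : SimpleGraph V} (hT : T.IsTree)
    {A : Matrix V V ℝ} (hA : MatrRG T A) :
    ∃ e : V → ℝ, (∀ v, 0 < e v) ∧ ∀ u w, e u * A u w = e w * A w u := by
  classical
  obtain ⟨r⟩ := hT.connected.nonempty
  have hpar : ∀ v, ∃ p, v ≠ r → T.Adj p v ∧ T.dist r v = T.dist r p + 1 := by
    intro v
    by_cases hv : v = r
    · exact ⟨v, fun h => absurd hv h⟩
    · obtain ⟨g, d, hgd⟩ : ∃ p, T.Adj v p ∧ T.dist r p + 1 = T.dist r v := by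
        obtain ⟨p, hp⟩ := hT.connected.exists_walk_length_eq_dist v r
        cases p with
        | nil => exact absurd rfl hv
        | @cons _ z _ hadj q =>
          refine ⟨z, hadj, ?_⟩
          have h1 := SimpleGraph.dist_le q
          simp only [SimpleGraph.Walk.length_cons] at hp
          rw [SimpleGraph.dist_comm] at hp h1
          have := hT.dist_eq_dist_add_one_of_adj r hadj
          omega
      exact ⟨g, fun _ => ⟨d.symm, hgd.symm⟩⟩
  choose par hp using hpar
  let E : ℕ → V → ℝ := fun n => Nat.rec (fun _ => 1)
    (fun _ F v => F (par v) * (A (par v) v / A v (par v))) n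
  have hE : ∀ n v, E (n + 1) v = E n (par v) * (A (par v) v / A v (par v)) := fun _ _ => rfl
  have hrec : ∀ v, v ≠ r → E (T.dist r v) v =
      E (T.dist r (par v)) (par v) * (A (par v) v / A v (par v)) := by
    intro v hv
    rw [(hp v hv).2, hE]
  have hpos : ∀ n v, T.dist r v = n → 0 < E n v := by
    intro n
    induction n with
    | zero => intro v _; exact one_pos
    | succ n ih =>
      intro v hv
      have hvr : v ≠ r := by
        rintro rfl
        simp at hv
      obtain ⟨h1, h2⟩ := hp v hvr
      rw [hE]
      refine mul_pos (ih _ (by omega)) ?_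
      have h3 := hA.2 _ _ h1
      rcases mul_pos_iff.1 h3 with h | h
      · exact div_pos h.1 h.2
      · exact div_pos_of_neg_of_neg h.1 h.2
  have hedge : ∀ u w, T.Adj u w → T.dist r w = T.dist r u + 1 →
      E (T.dist r u) u * A u w = E (T.dist r w) w * A w u := by
    intro u w huw hd
    have hwr : w ≠ r := by
      rintro rfl
      simp at hd
    have hpu : par w = u := tree_parent_unique hT r (hp w hwr).1 huw (hp w hwr).2 hd
    have h1 := hrec w hwr
    rw [hpu] at h1
    have hne : A w u ≠ 0 := (hA.1 _ _ huw.ne').2 huw.symm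
    rw [h1]
    field_simp
  refine ⟨fun v => E (T.dist r v) v, fun v => hpos _ v rfl, ?_⟩
  intro u w
  by_cases huw : u = w
  · rw [huw]
  by_cases hadj : T.Adj u w
  · rcases hT.dist_eq_dist_add_one_of_adj r hadj with h | h
    · exact (hedge w u hadj.symm h).symm
    · exact hedge u w hadj h
  · have h1 : A u w = 0 := by
      by_contra h
      exact hadj ((hA.1 _ _ huw).1 h)
    have h2 : A w u = 0 := by
      by_contra h
      exact hadj ((hA.1 _ _ (Ne.symm huw)).1 h).symm
    rw [h1, h2, mul_zero, mul_zero]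

theorem matrRG_sub {V : Type*} [Fintype V] [DecidableEq V] {T : SimpleGraph V}
    {A : Matrix V V ℝ} (hA : MatrRG T A) (lam : ℝ) :
    MatrRG T (A - Matrix.scalar V lam) := by
  have h : ∀ u w, u ≠ w → (A - Matrix.scalar V lam) u w = A u w := by
    intro u w huw
    simp [huw]
  refine ⟨fun u w huw => by rw [h u w huw]; exact hA.1 u w huw, fun u w huw => ?_⟩
  rw [h u w huw.ne, h w u huw.ne']
  exact hA.2 u w huw

theorem ker_sq {V : Type*} [Fintype V] {T : SimpleGraph V} (hT : T.IsTree)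
    {A : Matrix V V ℝ} (hA : MatrRG T A) (x : V → ℝ) (hx : A.mulVec (A.mulVec x) = 0) :
    A.mulVec x = 0 := by
  obtain ⟨e, he, hs⟩ := exists_symmetrizer hT hA
  set y := A.mulVec x with hy
  have h1 : ∑ v, e v * (y v * y v) = 0 := by
    calc ∑ v, e v * (y v * y v) = ∑ v, ∑ w, (e v * A v w) * x w * y v := by
          refine Finset.sum_congr rfl fun v _ => ?_
          have : y v = ∑ w, A v w * x w := rfl
          conv_lhs => rw [this]
          rw [← this, this, Finset.sum_mul, Finset.mul_sum]
          refine Finset.sum_congr rfl fun w _ => ?_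
          ring
      _ = ∑ w, ∑ v, (e w * A w v) * x w * y v := by
          rw [Finset.sum_comm]
          refine Finset.sum_congr rfl fun w _ => Finset.sum_congr rfl fun v _ => ?_
          rw [hs]
      _ = ∑ w, e w * x w * (A.mulVec y) w := by
          refine Finset.sum_congr rfl fun w _ => ?_
          simp only [Matrix.mulVec, dotProduct, Finset.mul_sum]
          refine Finset.sum_congr rfl fun v _ => ?_
          ring
      _ = 0 := by simp [hx]
  rw [Finset.sum_eq_zero_iff_of_nonneg
    (fun v _ => mul_nonneg (he v).le (mul_self_nonneg _))] at h1
  ext v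
  have := h1 v (Finset.mem_univ v)
  rcases mul_eq_zero.1 this with h | h
  · exact absurd h (he v).ne'
  · simpa using h

theorem rootMultiplicity_eq_nullity {V : Type*} [Fintype V] [DecidableEq V] {T : SimpleGraph V}
    (hT : T.IsTree) {A : Matrix V V ℝ} (hA : MatrRG T A) (lam : ℝ) :
    Polynomial.rootMultiplicity lam A.charpoly =
      Module.finrank ℝ (LinearMap.ker (A - Matrix.scalar V lam).mulVecLin) := by
  have hφ : (Matrix.toLin' A).charpoly = A.charpoly := by simp
  rw [← hφ, ← LinearMap.finrank_maxGenEigenspace_eq]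
  have hN : Matrix.toLin' A - algebraMap ℝ (Module.End ℝ (V → ℝ)) lam
      = (A - Matrix.scalar V lam).mulVecLin := by
    ext v w
    simp [Matrix.mulVec_single, Algebra.algebraMap_eq_smul_one, Matrix.diagonal_apply,
      Pi.single_apply]
  have hk : ∀ (k : ℕ) (x : V → ℝ), ((A - Matrix.scalar V lam).mulVecLin ^ k) x = 0 →
      (A - Matrix.scalar V lam).mulVec x = 0 := by
    intro k
    induction k with
    | zero => intro x hx; simp at hx; simp [hx]
    | succ k ih =>
      intro x hx
      rw [pow_succ, Module.End.mul_apply] at hx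
      exact ker_sq hT (matrRG_sub hA lam) x (ih _ hx)
  have heq : Module.End.maxGenEigenspace (Matrix.toLin' A) lam =
      LinearMap.ker (A - Matrix.scalar V lam).mulVecLin := by
    ext x
    rw [Module.End.mem_maxGenEigenspace]
    simp only [← Algebra.algebraMap_eq_smul_one]
    rw [hN]
    constructor
    · rintro ⟨k, hx⟩
      exact LinearMap.mem_ker.2 (hk k x hx)
    · intro hx
      exact ⟨1, by rw [pow_one]; exact LinearMap.mem_ker.1 hx⟩
  rw [heq]

/-- (Corollary 5.7) Let `T` be a tree, `A ∈ 𝓡(T)`, and `T_1, …, T_c`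
mutually independent subtrees of `T`.  (1) If `nullity(A) > P(T ∖ (T_1 ∪ ⋯ ∪ T_c))`, then
some `A[T_i]` is not invertible.  (2) If `mult(λ, A) > P(T ∖ (T_1 ∪ ⋯ ∪ T_c))`, then `λ` is
an eigenvalue of some `A[T_i]`. -/
theorem invertible_subtrees_corollary {V : Type*} [Fintype V] [DecidableEq V]
    (T : SimpleGraph V) (hT : T.IsTree)
    (A : Matrix V V ℝ) (hA : MatrRG T A)
    (c : ℕ) (hc : 1 ≤ c) (S : Fin c → Finset V)
    (hsub : ∀ i, (T.induce ((S i : Finset V) : Set V)).Connected)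
    (hindep : ∀ i j, i ≠ j → ∀ u ∈ S i, ∀ w ∈ S j, ¬T.Adj u w) :
    (pathCoverNumber T (Finset.univ \ Finset.univ.biUnion S)
        < Module.finrank ℝ (LinearMap.ker A.mulVecLin) →
      ∃ i, ¬ IsUnit (A.submatrix
        (fun x : {x // x ∈ S i} => (x : V)) (fun x : {x // x ∈ S i} => (x : V)))) ∧
    (∀ lam : ℝ,
      pathCoverNumber T (Finset.univ \ Finset.univ.biUnion S)
          < Polynomial.rootMultiplicity lam A.charpoly →
      ∃ i, (A.submatrix
        (fun x : {x // x ∈ S i} => (x : V))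
        (fun x : {x // x ∈ S i} => (x : V))).charpoly.IsRoot lam) := by
  have main : ∀ B : Matrix V V ℝ, MatrRG T B →
      pathCoverNumber T (Finset.univ \ Finset.univ.biUnion S)
        < Module.finrank ℝ (LinearMap.ker B.mulVecLin) →
      ∃ i, ¬ IsUnit (B.submatrix
        (fun x : {x // x ∈ S i} => (x : V)) (fun x : {x // x ∈ S i} => (x : V))) := by
    intro B hB hlt
    by_contra hno
    push Not at hno
    obtain ⟨C, hC, hcard⟩ := pathCover_exists T (Finset.univ \ Finset.univ.biUnion S)
    have := nullity_le_of_cover T hT B hB c S hsub hindep hno C hC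
    omega
  refine ⟨main A hA, ?_⟩
  intro lam hlt
  rw [rootMultiplicity_eq_nullity hT hA] at hlt
  obtain ⟨i, hi⟩ := main _ (matrRG_sub hA lam) hlt
  refine ⟨i, ?_⟩
  rw [Polynomial.IsRoot.def, Matrix.eval_charpoly]
  rw [Matrix.isUnit_iff_isUnit_det, isUnit_iff_ne_zero, not_not] at hi
  rw [← neg_sub, Matrix.det_neg]
  have : (A - Matrix.scalar V lam).submatrix
      (fun x : {x // x ∈ S i} => (x : V)) (fun x : {x // x ∈ S i} => (x : V)) =
      A.submatrix (fun x : {x // x ∈ S i} => (x : V)) (fun x : {x // x ∈ S i} => (x : V))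
        - Matrix.scalar _ lam := by
    ext a b
    by_cases hab : a = b
    · subst hab
      simp
    · have : (a : V) ≠ b := fun h => hab (Subtype.ext h)
      simp [hab, this]
  rw [← this, hi, mul_zero]
end

section
/- Let T be a tree and A = (a_{ij}) ∈ R(T), and suppose λ is an eigenvalue of A with mult(λ, A) = P(T). Then every vertex v of T that occurs as a singleton path in some minimum path cover of T satisfies a_{vv} = λ. -/
namespace DiagAux

open SimpleGraph

/-- Symmetrizing weights on a tree. -/
theorem exists_weights {V : Type*} (T : SimpleGraph V) (hT : T.IsTree)
    (A : Matrix V V ℝ) (hA : MatrRG T A) :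
    ∃ d : V → ℝ, (∀ u, 0 < d u) ∧ ∀ u w, d u * A u w = d w * A w u := by
  classical
  obtain ⟨r⟩ := hT.connected.nonempty
  choose p hp _ using fun w => hT.existsUnique_path r w
  let g : T.Dart → ℝ := fun e => A e.fst e.snd / A e.snd e.fst
  have hg : ∀ e, 0 < g e := by
    intro e
    have h := hA.2 _ _ e.adj
    rcases mul_pos_iff.1 h with h | h
    · exact div_pos h.1 h.2
    · exact div_pos_of_neg_of_neg h.1 h.2
  have key : ∀ u w (h : T.Adj u w), p w = (p u).concat h →
      ((p u).darts.map g).prod * A u w = ((p w).darts.map g).prod * A w u := by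
    intro u w h e
    have h0 : A w u ≠ 0 := (hA.1 w u h.ne').2 h.symm
    rw [e]
    simp only [Walk.darts_concat, List.concat_eq_append, List.map_append, List.prod_append,
      List.map_cons, List.map_nil, List.prod_cons, List.prod_nil, g]
    field_simp
  refine ⟨fun w => ((p w).darts.map g).prod, ?_, ?_⟩
  · intro u
    apply List.prod_pos
    intro a ha
    obtain ⟨e, -, rfl⟩ := List.mem_map.1 ha
    exact hg e
  · intro u w
    by_cases huw : u = w
    · rw [huw]
    by_cases h : T.Adj u w
    · by_cases hs : u ∈ (p w).support
      · exact key u w h (hT.isAcyclic.path_concat (hp u) (hp w) h hs)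
      · have hs' := hT.isAcyclic.mem_support_of_ne_mem_support_of_adj_of_isPath (hp u) (hp w) h hs
        exact (key w u h.symm (hT.isAcyclic.path_concat (hp w) (hp u) h.symm hs')).symm
    · have h1 : A u w = 0 := by
        by_contra h1
        exact h ((hA.1 u w huw).1 h1)
      have h2 : A w u = 0 := by
        by_contra h2
        exact h ((hA.1 w u (Ne.symm huw)).1 h2).symm
      rw [h1, h2]; simp

theorem finrank_ge {V : Type*} [Fintype V] [DecidableEq V] (T : SimpleGraph V) (hT : T.IsTree)
    (A : Matrix V V ℝ) (hA : MatrRG T A) (lam : ℝ) :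
    Polynomial.rootMultiplicity lam A.charpoly ≤
      Module.finrank ℝ (LinearMap.ker (Matrix.toLin' A - lam • 1)) := by
  obtain ⟨d, hd, hs⟩ := exists_weights T hT A hA
  rw [← Matrix.charpoly_toLin', ← LinearMap.finrank_maxGenEigenspace_eq]
  apply Submodule.finrank_mono
  set M : Module.End ℝ (V → ℝ) := Matrix.toLin' A - lam • 1 with hM
  have hsym : ∀ x y : V → ℝ, ∑ u, d u * (M x u * y u) = ∑ u, d u * (x u * M y u) := by
    intro x y
    have e1 : ∀ (x : V → ℝ) u, M x u = ∑ w, A u w * x w - lam * x u := by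
      intro x u
      simp [hM, Matrix.mulVec, dotProduct]
    simp only [e1, sub_mul, mul_sub, Finset.sum_sub_distrib, Finset.sum_mul, Finset.mul_sum]
    congr 1
    · rw [Finset.sum_comm]
      refine Finset.sum_congr rfl fun u _ => Finset.sum_congr rfl fun w _ => ?_
      have := hs u w
      linear_combination (-(x u * y w)) * this
    · refine Finset.sum_congr rfl fun u _ => by ring
  have h2 : ∀ x, M (M x) = 0 → M x = 0 := by
    intro x hx
    have h := hsym (M x) x
    rw [hx] at h
    simp only [Pi.zero_apply, zero_mul, mul_zero, Finset.sum_const_zero] at h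
    have h' := (Finset.sum_eq_zero_iff_of_nonneg (fun u _ =>
      mul_nonneg (hd u).le (mul_self_nonneg (M x u)))).1 h.symm
    funext u
    have := h' u (Finset.mem_univ u)
    have := (mul_eq_zero.1 this).resolve_left (hd u).ne'
    exact mul_self_eq_zero.1 this
  have hk : ∀ (k : ℕ) x, (M ^ k) x = 0 → M x = 0 := by
    intro k
    induction k with
    | zero => intro x hx; simp at hx; simp [hx]
    | succ k ih =>
      intro x hx
      rw [pow_succ] at hx
      exact h2 x (ih _ hx)
  intro x hx
  obtain ⟨k, hx⟩ := Module.End.mem_maxGenEigenspace _ _ _ |>.1 hx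
  exact hk k x hx

/-- Orientation data extracted from a path cover. -/
theorem exists_orient {V : Type*} [Fintype V] [DecidableEq V] (T : SimpleGraph V)
    (C : Finset (Finset V)) (hC : IsPathCoverOn T Finset.univ C) (v : V) (hv : {v} ∈ C) :
    ∃ (B : Finset V) (pred : V → V), B.card ≤ C.card ∧ v ∈ B ∧
      (∀ w, w ∉ B → T.Adj w (pred w)) ∧
      (∀ w w', w ∉ B → w' ∉ B → pred w = pred w' → w = w') ∧
      (∀ w, w ∉ B → pred w ∉ B → pred (pred w) ≠ w) ∧
      (∀ w, w ∉ B → pred w ≠ v) := by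
  classical
  have h1 : ∀ S : Finset V, ∃ (n : ℕ) (f : ℕ → V), S ∈ C →
      0 < n ∧ (∀ i j, i < n → j < n → f i = f j → i = j) ∧
      (∀ w, w ∈ S ↔ ∃ i, i < n ∧ f i = w) ∧
      (∀ i, i + 1 < n → T.Adj (f (i+1)) (f i)) := by
    intro S
    by_cases hS : S ∈ C
    · obtain ⟨n, f, hn, hinj, him, hadj⟩ := (hC.1 S hS).2
      refine ⟨n, fun i => if h : i < n then f ⟨i, h⟩ else f ⟨0, hn⟩, fun _ => ⟨hn, ?_, ?_, ?_⟩⟩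
      · intro i j hi hj h
        simp only [hi, hj, dif_pos] at h
        simpa using hinj h
      · intro w
        rw [← him]
        constructor
        · intro h
          obtain ⟨i, -, rfl⟩ := Finset.mem_image.1 h
          exact ⟨i, i.2, by simp⟩
        · rintro ⟨i, hi, rfl⟩
          simp [hi]
      · intro i hi
        have hi' : i < n := by omega
        simp only [hi, hi', dif_pos]
        exact (hadj _ _).2 (Or.inr rfl)
    · exact ⟨0, fun _ => v, fun h => absurd h hS⟩
  choose n f hf using h1
  choose P hP hPu using fun w => hC.2 w (Finset.mem_univ w)
  have hidx : ∀ w, ∃ i, i < n (P w) ∧ f (P w) i = w := fun w =>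
    ((hf (P w) (hP w).1).2.2.1 w).1 (hP w).2
  choose idx hidx1 hidx2 using hidx
  have hPf : ∀ w i, i < n (P w) → P (f (P w) i) = P w := by
    intro w i hi
    have hm : f (P w) i ∈ P w := ((hf (P w) (hP w).1).2.2.1 _).2 ⟨i, hi, rfl⟩
    exact (hPu _ (P w) ⟨(hP w).1, hm⟩).symm
  have hidxf : ∀ w i, i < n (P w) → idx (f (P w) i) = i := by
    intro w i hi
    have e := hPf w i hi
    have a := hidx1 (f (P w) i)
    have b := hidx2 (f (P w) i)
    rw [e] at a b
    exact (hf (P w) (hP w).1).2.1 _ _ a hi b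
  have hB : ∀ w, w ∉ C.image (fun S => f S 0) → 0 < idx w := by
    intro w hw
    by_contra h
    apply hw
    refine Finset.mem_image.2 ⟨P w, (hP w).1, ?_⟩
    have := hidx2 w
    rwa [show idx w = 0 by omega] at this
  have hpP : ∀ w, P (f (P w) (idx w - 1)) = P w := fun w =>
    hPf w _ (by have := hidx1 w; omega)
  have hpI : ∀ w, idx (f (P w) (idx w - 1)) = idx w - 1 := fun w =>
    hidxf w _ (by have := hidx1 w; omega)
  have hext : ∀ w w', P w = P w' → idx w = idx w' → w = w' := by
    intro w w' h h'
    rw [← hidx2 w, ← hidx2 w', h, h']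
  refine ⟨C.image (fun S => f S 0), fun w => f (P w) (idx w - 1), Finset.card_image_le,
    ?_, ?_, ?_, ?_, ?_⟩
  · refine Finset.mem_image.2 ⟨{v}, hv, ?_⟩
    have h := hf {v} hv
    exact Finset.mem_singleton.1 ((h.2.2.1 _).2 ⟨0, h.1, rfl⟩)
  · intro w hw
    have h0 := hB w hw
    have h := (hf (P w) (hP w).1).2.2.2 (idx w - 1) (by have := hidx1 w; omega)
    rwa [show idx w - 1 + 1 = idx w by omega, hidx2] at h
  · intro w w' hw hw' h
    have h0 := hB w hw
    have h0' := hB w' hw'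
    have e1 := hpP w
    have e2 := hpI w
    simp only at h
    rw [h, hpP] at e1
    rw [h, hpI] at e2
    exact hext _ _ e1.symm (by omega)
  · intro w hw hw' h
    have h0 := hB w hw
    have e2 := hpI (f (P w) (idx w - 1))
    simp only at h
    rw [h, hpI] at e2
    omega
  · intro w hw h
    have hm : v ∈ P w := ((hf (P w) (hP w).1).2.2.1 v).2
      ⟨idx w - 1, by have := hidx1 w; omega, h⟩
    have e1 : P w = {v} := by
      rw [hPu v (P w) ⟨(hP w).1, hm⟩]
      exact (hPu v {v} ⟨hv, by simp⟩).symm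
    have h2 := (hP w).2
    rw [e1, Finset.mem_singleton] at h2
    have e2 := hpI w
    rw [show f (P w) (idx w - 1) = w by rw [h2] at h ⊢; exact h] at e2
    have h0 := hB w hw
    omega

theorem step {V : Type*} [Fintype V] [DecidableEq V] (T : SimpleGraph V) (hT : T.IsAcyclic)
    (A : Matrix V V ℝ) (hA : MatrRG T A) (lam : ℝ) (B : Finset V) (pred : V → V)
    (hadj : ∀ w, w ∉ B → T.Adj w (pred w))
    (hinj : ∀ w w', w ∉ B → w' ∉ B → pred w = pred w' → w = w')
    (hcyc : ∀ w, w ∉ B → pred w ∉ B → pred (pred w) ≠ w)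
    (x : V → ℝ) (hx : ∀ u, ∑ z, A u z * x z = lam * x u)
    (a w : V) (p : T.Walk a w) (hp : p.IsPath) (hw : w ∉ B) (hxw : x w ≠ 0)
    (hpred : pred w ∉ p.support) :
    ∃ (w' : V) (q : T.Walk a w'), q.IsPath ∧ p.length < q.length ∧ x w' ≠ 0 ∧
      (w' ∉ B → pred w' ∉ q.support) := by
  have hwu := hadj w hw
  have hp1 : (p.concat hwu).IsPath := hp.concat hpred hwu
  have h1 : ∃ z, z ≠ w ∧ (z = pred w ∨ T.Adj (pred w) z) ∧ x z ≠ 0 := by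
    by_contra hcon
    push Not at hcon
    have hu : x (pred w) = 0 := hcon _ hwu.ne' (Or.inl rfl)
    have h := hx (pred w)
    rw [hu, mul_zero, Finset.sum_eq_single w] at h
    · rcases mul_eq_zero.1 h with h | h
      · exact (hA.1 _ _ hwu.ne').2 hwu.symm h
      · exact hxw h
    · intro z _ hz
      by_cases hzu : z = pred w
      · rw [hzu, hu, mul_zero]
      by_cases hza : T.Adj (pred w) z
      · rw [hcon z hz (Or.inr hza), mul_zero]
      · have : A (pred w) z = 0 := by
          by_contra h0
          exact hza ((hA.1 _ _ (Ne.symm hzu)).1 h0)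
        rw [this, zero_mul]
    · simp
  obtain ⟨z, hzw, hz, hxz⟩ := h1
  rcases hz with rfl | hz
  · refine ⟨pred w, p.concat hwu, hp1, by simp, hxz, fun hB hmem => ?_⟩
    have := hT.eq_penultimate_of_adj_end hp1 (hadj _ hB) hmem
    rw [Walk.penultimate_concat] at this
    exact hcyc w hw hB this
  · have hz1 : z ∉ (p.concat hwu).support := by
      intro hmem
      have := hT.eq_penultimate_of_adj_end hp1 hz hmem
      rw [Walk.penultimate_concat] at this
      exact hzw this
    have hp2 := hp1.concat hz1 hz
    refine ⟨z, (p.concat hwu).concat hz, hp2, by simp, hxz, fun hB hmem => ?_⟩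
    have := hT.eq_penultimate_of_adj_end hp2 (hadj _ hB) hmem
    rw [Walk.penultimate_concat] at this
    exact hzw (hinj z w hB hw this)

theorem no_walk {V : Type*} [Fintype V] [DecidableEq V] (T : SimpleGraph V) (hT : T.IsAcyclic)
    (A : Matrix V V ℝ) (hA : MatrRG T A) (lam : ℝ) (B : Finset V) (pred : V → V)
    (hadj : ∀ w, w ∉ B → T.Adj w (pred w))
    (hinj : ∀ w w', w ∉ B → w' ∉ B → pred w = pred w' → w = w')
    (hcyc : ∀ w, w ∉ B → pred w ∉ B → pred (pred w) ≠ w)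
    (x : V → ℝ) (hx : ∀ u, ∑ z, A u z * x z = lam * x u)
    (a : V) (hB : ∀ b ∈ B, x b ≠ 0 → b = a) (k : ℕ) :
    ∀ (w : V) (p : T.Walk a w), p.IsPath → 0 < p.length → Fintype.card V ≤ p.length + k →
      x w ≠ 0 → (w ∉ B → pred w ∉ p.support) → False := by
  induction k with
  | zero =>
    intro w p hp _ h _ _
    have := hp.length_lt
    omega
  | succ k ih =>
    intro w p hp h0 hk hxw hpred
    have hwa : w ≠ a := by
      rintro rfl
      have := Walk.nil_iff_length_eq.1 (Walk.isPath_iff_nil.1 hp)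
      omega
    have hw : w ∉ B := fun h => hwa (hB w h hxw)
    obtain ⟨w', q, hq, hl, hxw', hpred'⟩ := step T hT A hA lam B pred hadj hinj hcyc x hx a w p hp
      hw hxw (hpred hw)
    exact ih w' q hq (by omega) (by omega) hxw' hpred'

end DiagAux

/-- (Corollary 5.8) Let `T` be a tree, `A ∈ 𝓡(T)`, and `λ` an eigenvalue
of `A` with `mult(λ, A) = P(T)`.  Then every vertex `v` of `T` that occurs as a singleton
path in some minimum path cover of `T` satisfies `a_{vv} = λ`. -/
theorem diag_eq_of_singleton_in_min_cover {V : Type*} [Fintype V] [DecidableEq V]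
    (T : SimpleGraph V) (hT : T.IsTree)
    (A : Matrix V V ℝ) (hA : MatrRG T A)
    (lam : ℝ) (heig : A.charpoly.IsRoot lam)
    (hmult : Polynomial.rootMultiplicity lam A.charpoly = pathCoverNumber T Finset.univ)
    (v : V)
    (hv : ∃ C : Finset (Finset V), IsPathCoverOn T Finset.univ C ∧
      C.card = pathCoverNumber T Finset.univ ∧ {v} ∈ C) :
    A v v = lam := by
  classical
  obtain ⟨C, hC, hCc, hvC⟩ := hv
  obtain ⟨B, pred, hBc, hvB, hadj, hinj, hcyc, hpv⟩ := DiagAux.exists_orient T C hC v hvC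
  have hfr := DiagAux.finrank_ge T hT A hA lam
  rw [hmult, ← hCc] at hfr
  set K := LinearMap.ker (Matrix.toLin' A - lam • (1 : Module.End ℝ (V → ℝ))) with hK
  have hKx : ∀ x ∈ K, ∀ u, ∑ z, A u z * x z = lam * x u := by
    intro x hx u
    have := congrFun (LinearMap.mem_ker.1 hx) u
    simp [Matrix.mulVec, dotProduct] at this
    linarith
  let R : K →ₗ[ℝ] (B → ℝ) := (LinearMap.funLeft ℝ ℝ (fun b : B => (b : V))).comp K.subtype
  have hR : Function.Injective R := by
    rw [← LinearMap.ker_eq_bot, LinearMap.ker_eq_bot']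
    rintro ⟨x, hxK⟩ hx
    have hxB : ∀ b ∈ B, x b = 0 := fun b hb => congrFun hx ⟨b, hb⟩
    have hx' := hKx x hxK
    ext w
    by_contra hxw
    have hxw : x w ≠ 0 := hxw
    have hw : w ∉ B := fun h => hxw (hxB w h)
    obtain ⟨w', q, hq, hl, hxw', hpred'⟩ := DiagAux.step T hT.isAcyclic A hA lam B pred hadj hinj
      hcyc x hx' w w SimpleGraph.Walk.nil (by simp) hw hxw (by simpa using (hadj w hw).ne')
    exact DiagAux.no_walk T hT.isAcyclic A hA lam B pred hadj hinj hcyc x hx' w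
      (fun b hb h => absurd (hxB b hb) h) (Fintype.card V) w' q hq (by omega) (by omega)
      hxw' hpred'
  have hle := LinearMap.finrank_le_finrank_of_injective hR
  have hcard : Module.finrank ℝ (B → ℝ) = B.card := by simp
  have hsurj : Function.Surjective R :=
    (LinearMap.injective_iff_surjective_of_finrank_eq_finrank (by omega)).1 hR
  obtain ⟨⟨x, hxK⟩, hxe⟩ := hsurj (Pi.single ⟨v, hvB⟩ 1)
  have hx' := hKx x hxK
  have hxv : x v = 1 := by
    have := congrFun hxe ⟨v, hvB⟩
    rw [Pi.single_eq_same] at this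
    exact this
  have hxB : ∀ b ∈ B, x b ≠ 0 → b = v := by
    intro b hb h
    by_contra hne
    have := congrFun hxe ⟨b, hb⟩
    rw [Pi.single_eq_of_ne (by simpa using hne)] at this
    exact h this
  have hnb : ∀ u, T.Adj v u → x u = 0 := by
    intro u hu
    by_contra hxu
    refine DiagAux.no_walk T hT.isAcyclic A hA lam B pred hadj hinj hcyc x hx' v hxB
      (Fintype.card V) u (SimpleGraph.Walk.cons hu SimpleGraph.Walk.nil) ?_ (by simp) (by omega)
      hxu ?_
    · simp [hu.ne]
    · intro huB
      simpa using ⟨hpv u huB, (hadj u huB).ne'⟩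
  have h := hx' v
  rw [hxv, Finset.sum_eq_single v, hxv] at h
  · linarith
  · intro z _ hz
    by_cases hza : T.Adj v z
    · rw [hnb z hza, mul_zero]
    · have : A v z = 0 := by
        by_contra h0
        exact hza ((hA.1 _ _ (Ne.symm hz)).1 h0)
      rw [this, zero_mul]
  · simp
end
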